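/- arXiv:2212.13091 — 3 statements merged into one kernel-verified Lean document; each statement's English description precedes it below -/
import Mathlib

section
/- Let R be a standard graded Noetherian ring over an Artinian local ring A, and M a finitely generated graded Cohen-Macaulay R-module of dimension d with Hilbert function h_M and Hilbert polynomial P_M. Then for all 0 ≤ i ≤ d and all n ∈ ℤ, (-1)^(d-i) · Δ^i(h_M - P_M)(n) ≥ 0, where Δ denotes the first difference operator Δ(f)(n) = f(n+1) - f(n). -/
/-- The first difference operator `Δ(f)(n) = f(n+1) - f(n)`. -/
noncomputable def deltaOp (f : ℤ → ℚ) : ℤ → ℚ := fun n => f (n + 1) - f n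

namespace Marley

open RingTheory.Sequence
open scoped Pointwise

lemma delta_shift (f : ℤ → ℚ) (d : ℕ) (n : ℤ) :
    deltaOp^[d] (fun n => f (n + 1)) n = deltaOp^[d] f (n + 1) := by
  induction d generalizing n with
  | zero => rfl
  | succ d ih =>
    rw [Function.iterate_succ_apply', Function.iterate_succ_apply']
    simp only [deltaOp, ih]

lemma exists_descend {A M N : Type*} [CommRing A] [AddCommGroup M] [Module A M]
    [AddCommGroup N] [Module A N] (f g : M →ₗ[A] N) (hf : Function.Surjective f)
    (h : LinearMap.ker f ≤ LinearMap.ker g) : ∃ k : N →ₗ[A] N, ∀ m, k (f m) = g m := by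
  refine ⟨((LinearMap.ker f).liftQ g h) ∘ₗ (f.quotKerEquivOfSurjective hf).symm.toLinearMap, ?_⟩
  intro m
  have : (f.quotKerEquivOfSurjective hf).symm (f m) = Submodule.Quotient.mk m := by
    rw [LinearEquiv.symm_apply_eq]; rfl
  simp [this]

lemma quot_regular_iff {R M : Type*} [CommRing R] [AddCommGroup M] [Module R M] (r l : R) :
    IsSMulRegular (QuotSMulTop r M) l ↔ ∀ m : M, (∃ u : M, l • m = r • u) → ∃ u : M, m = r • u := by
  rw [isSMulRegular_quotient_iff_mem_of_smul_mem]
  simp only [Submodule.mem_smul_pointwise_iff_exists, Submodule.mem_top, true_and]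
  constructor
  · rintro h m ⟨u, hu⟩
    obtain ⟨v, hv⟩ := h m ⟨u, hu.symm⟩
    exact ⟨v, hv.symm⟩
  · rintro h m ⟨u, hu⟩
    obtain ⟨v, hv⟩ := h m ⟨u, hu.symm⟩
    exact ⟨v, hv.symm⟩

lemma swap_reg {R M : Type*} [CommRing R] [AddCommGroup M] [Module R M] {r l : R}
    (hr : IsSMulRegular M r)
    (h : IsSMulRegular (QuotSMulTop r M) l) : IsSMulRegular (QuotSMulTop l M) r := by
  rw [quot_regular_iff] at h ⊢
  rintro m ⟨u, hu⟩
  obtain ⟨v, rfl⟩ := h u ⟨m, hu.symm⟩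
  refine ⟨v, hr ?_⟩
  simp only [hu]
  rw [smul_comm]

/-- `(M/l)/r ≃ (M/r)/l`. -/
noncomputable def quotSwap {R : Type*} (M : Type*) [CommRing R] [AddCommGroup M] [Module R M] (r l : R) :
    QuotSMulTop r (QuotSMulTop l M) ≃ₗ[R] QuotSMulTop l (QuotSMulTop r M) :=
  Submodule.quotEquivOfEq _ _ (by rw [Submodule.map_pointwise_smul, Submodule.map_top, Submodule.range_mkQ])
  ≪≫ₗ (Submodule.quotientQuotientEquivQuotientSup (l • (⊤ : Submodule R M)) (r • ⊤))
  ≪≫ₗ Submodule.quotEquivOfEq _ _ (sup_comm _ _)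
  ≪≫ₗ (Submodule.quotientQuotientEquivQuotientSup (r • (⊤ : Submodule R M)) (l • ⊤)).symm
  ≪≫ₗ Submodule.quotEquivOfEq _ _ (by rw [Submodule.map_pointwise_smul, Submodule.map_top, Submodule.range_mkQ])

lemma exists_primes {R : Type*} [CommRing R] [IsNoetherianRing R] (I : Ideal R) (rs : List R) :
    ∀ (M : Type*) [AddCommGroup M] [Module R M] [Module.Finite R M],
    rs ≠ [] → (∀ r ∈ rs, r ∈ I.radical) → IsWeaklyRegular M rs →
    ∃ F : Set (Ideal R), F.Finite ∧ (∀ p ∈ F, p.IsPrime ∧ ¬ I ≤ p) ∧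
      ∀ l : R, (∀ p ∈ F, l ∉ p) →
        IsSMulRegular M l ∧ IsWeaklyRegular (QuotSMulTop l M) rs.dropLast := by
  induction rs with
  | nil => intro M _ _ _ h; exact absurd rfl h
  | cons r rs ih =>
    intro M _ _ _ _ hI hreg
    rw [isWeaklyRegular_cons_iff] at hreg
    have hAss : ∀ l : R, (∀ p ∈ associatedPrimes R M, l ∉ p) ↔ IsSMulRegular M l := by
      intro l
      have := biUnion_associatedPrimes_eq_compl_regular R M
      have h2 := Set.ext_iff.mp this l
      simp only [Set.mem_iUnion, Set.mem_compl_iff, Set.mem_ofPred_eq, SetLike.mem_coe] at h2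
      rw [← not_iff_not, ← h2]; push Not; simp
    have hgood : ∀ p ∈ associatedPrimes R M, p.IsPrime ∧ ¬ I ≤ p := by
      intro p hp
      have hpr : p.IsPrime := hp.isPrime
      refine ⟨hpr, fun hle => ?_⟩
      have := (hAss r).mpr hreg.1 p hp
      exact this ((Ideal.radical_mono hle).trans hpr.radical.le (hI r (by simp)))
    by_cases hrs : rs = []
    · subst hrs
      refine ⟨associatedPrimes R M, associatedPrimes.finite R M, hgood, fun l hl => ⟨(hAss l).mp hl, ?_⟩⟩
      simp
    · obtain ⟨F, hF, hF1, hF2⟩ := ih (QuotSMulTop r M) hrs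
        (fun s hs => hI s (by simp [hs])) hreg.2
      refine ⟨F ∪ associatedPrimes R M, hF.union (associatedPrimes.finite R M), ?_, ?_⟩
      · rintro p (hp | hp)
        · exact hF1 p hp
        · exact hgood p hp
      · intro l hl
        have h1 := (hAss l).mp (fun p hp => hl p (Or.inr hp))
        obtain ⟨h2, h3⟩ := hF2 l (fun p hp => hl p (Or.inl hp))
        refine ⟨h1, ?_⟩
        rw [List.dropLast_cons_of_ne_nil hrs, isWeaklyRegular_cons_iff]
        exact ⟨swap_reg hreg.1 h2, ((quotSwap M r l).isWeaklyRegular_congr _).mpr h3⟩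

open Classical in
lemma exists_avoid {A R : Type*} [CommRing A] [CommRing R] [Algebra A R] {m : ℕ} (x : Fin m → R)
    (c : ℕ → A) (hc : ∀ i j, i ≠ j → IsUnit (c i - c j)) (F : Set (Ideal R)) (hF : F.Finite)
    (hp : ∀ p ∈ F, p.IsPrime ∧ ¬ Ideal.span (Set.range x) ≤ p) :
    ∃ j, ∀ p ∈ F, ∑ i : Fin m, (c j ^ (i : ℕ)) • x i ∉ p := by
  by_contra hcon
  push Not at hcon
  have hbad : ∀ p ∈ F, {j : ℕ | ∑ i : Fin m, (c j ^ (i : ℕ)) • x i ∈ p}.Finite := by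
    intro p hpF
    obtain ⟨hpr, hle⟩ := hp p hpF
    let q := Ideal.Quotient.mk p
    let f : Polynomial (R ⧸ p) := ∑ i : Fin m, Polynomial.monomial (i : ℕ) (q (x i))
    have hf : f ≠ 0 := by
      intro h0
      apply hle
      rw [Ideal.span_le]
      rintro _ ⟨i, rfl⟩
      have : f.coeff (i : ℕ) = q (x i) := by
        simp only [f, Polynomial.finsetSum_coeff, Polynomial.coeff_monomial]
        rw [Finset.sum_eq_single i]
        · simp
        · intro b _ hb
          rw [if_neg]; exact fun h => hb (Fin.ext h)
        · simp
      rw [h0, Polynomial.coeff_zero] at this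
      exact Ideal.Quotient.eq_zero_iff_mem.mp this.symm
    have hinj : Set.InjOn (fun j => q (algebraMap A R (c j))) {j : ℕ | ∑ i : Fin m, (c j ^ (i : ℕ)) • x i ∈ p} := by
      intro i _ j _ hij
      by_contra hne
      have hu := (hc i j hne).map (q.comp (algebraMap A R))
      simp only [map_sub, RingHom.comp_apply] at hu
      simp only at hij
      rw [hij, sub_self] at hu
      exact not_isUnit_zero hu
    refine Set.Finite.of_finite_image ?_ hinj
    refine (f.roots.toFinset.finite_toSet).subset ?_
    rintro _ ⟨j, hj, rfl⟩
    simp only [Finset.mem_coe, Multiset.mem_toFinset, Polynomial.mem_roots hf, Polynomial.IsRoot.def]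
    have := Ideal.Quotient.eq_zero_iff_mem.mpr hj
    rw [← this]
    simp only [f, Polynomial.eval_finsetSum, Polynomial.eval_monomial, map_sum, Algebra.smul_def,
      map_mul, map_pow, q]
    exact Finset.sum_congr rfl fun i _ => mul_comm _ _
  have : (Set.univ : Set ℕ).Finite := by
    refine (hF.biUnion hbad).subset ?_
    intro j _
    obtain ⟨p, hpF, h⟩ := hcon j
    simp only [Set.mem_iUnion]
    exact ⟨p, hpF, h⟩
  exact Set.infinite_univ this

lemma exists_quot (A : Type*) {R : Type*} (M : Type*) [CommRing A] [CommRing R] [Algebra A R]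
    [AddCommGroup M] [Module A M] [Module R M] [IsScalarTower A R M] (l : R) :
    ∃ q : M →ₗ[A] QuotSMulTop l M, Function.Surjective q ∧ (∀ u, q u = 0 ↔ ∃ v : M, u = l • v) ∧
      (∀ (r : R) u, q (r • u) = r • q u) := by
  refine ⟨(Submodule.mkQ (l • (⊤ : Submodule R M))).restrictScalars A,
    Submodule.mkQ_surjective (l • (⊤ : Submodule R M)), ?_, ?_⟩
  · intro u
    rw [LinearMap.restrictScalars_apply, Submodule.mkQ_apply, Submodule.Quotient.mk_eq_zero,
      Submodule.mem_smul_pointwise_iff_exists]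
    constructor
    · rintro ⟨v, _, hv⟩; exact ⟨v, hv.symm⟩
    · rintro ⟨v, hv⟩; exact ⟨v, trivial, hv.symm⟩
  · exact fun r u => map_smul (Submodule.mkQ (l • (⊤ : Submodule R M))) r u

/-- Main induction: with enough scalars, the `d`-th difference of the Hilbert function is
non-negative when there is a regular sequence of length `d`. -/
lemma delta_nonneg {A R : Type*} [CommRing A] [CommRing R] [IsNoetherianRing R] [Algebra A R]
    {m : ℕ} (x : Fin m → R) (c : ℕ → A) (hc : ∀ i j, i ≠ j → IsUnit (c i - c j)) (d : ℕ) :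
    ∀ (M : Type*) [AddCommGroup M] [Module A M] [Module R M] [IsScalarTower A R M]
      [Module.Finite R M] (rs : List R), rs.length = d →
      (∀ r ∈ rs, r ∈ (Ideal.span (Set.range x)).radical) → IsWeaklyRegular M rs →
      ∀ (π : ℤ → M →ₗ[A] M) (_ : ∀ n u, π n (π n u) = π n u)
        (_ : ∀ n i u, π (n + 1) (x i • u) = x i • π n u)
        (h : ℤ → ℕ) (_ : ∀ n, (h n : ℕ∞) = Module.length A (LinearMap.range (π n))) (n : ℤ),
        0 ≤ deltaOp^[d] (fun n => (h n : ℚ)) n := by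
  induction d with
  | zero => intros; simp
  | succ d ih =>
    intro M _ _ _ _ _ rs hlen hI hreg π hπ hx h hh n
    obtain ⟨F, hF, hF1, hF2⟩ := exists_primes (Ideal.span (Set.range x)) rs M
      (by rintro rfl; simp at hlen) hI hreg
    obtain ⟨j, hj⟩ := exists_avoid x c hc F hF hF1
    obtain ⟨l, hl⟩ : ∃ l, l = ∑ i : Fin m, (c j ^ (i : ℕ)) • x i := ⟨_, rfl⟩
    rw [← hl] at hj
    obtain ⟨hl1, hl2⟩ := hF2 l hj
    have hlx : ∀ n u, π (n + 1) (l • u) = l • π n u := by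
      intro n u
      simp only [hl, Finset.sum_smul, map_sum, smul_assoc, map_smul, hx]
    obtain ⟨q, hq, hq0, hqR⟩ := exists_quot A M l
    have hex : ∀ n, ∃ k : QuotSMulTop l M →ₗ[A] QuotSMulTop l M, ∀ u, k (q u) = q (π n u) := by
      intro n
      refine exists_descend q (q ∘ₗ π n) hq ?_
      intro u hu
      rw [LinearMap.mem_ker, hq0] at hu
      obtain ⟨v, rfl⟩ := hu
      rw [LinearMap.mem_ker, LinearMap.comp_apply, hq0]
      refine ⟨π (n - 1) v, ?_⟩
      rw [← hlx, sub_add_cancel]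
    choose ϖ hϖ using hex
    -- exact sequence
    have hlen' : ∀ n, Module.length A (LinearMap.range (π (n + 1))) =
        Module.length A (LinearMap.range (π n)) + Module.length A (LinearMap.range (ϖ (n + 1))) := by
      intro n
      let f : LinearMap.range (π n) →ₗ[A] LinearMap.range (π (n + 1)) :=
        (Algebra.lsmul A A M l).restrict (by
          rintro _ ⟨u, rfl⟩
          exact ⟨l • u, hlx n u⟩)
      let g : LinearMap.range (π (n + 1)) →ₗ[A] LinearMap.range (ϖ (n + 1)) :=
        q.restrict (by
          rintro _ ⟨u, rfl⟩
          exact ⟨q u, hϖ _ u⟩)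
      refine Module.length_eq_add_of_exact f g ?_ ?_ ?_
      · intro a b hab
        apply Subtype.ext
        exact hl1 (congrArg Subtype.val hab)
      · rintro ⟨_, ⟨w, rfl⟩⟩
        obtain ⟨u, rfl⟩ := hq w
        exact ⟨⟨π (n + 1) u, u, rfl⟩, Subtype.ext (hϖ _ u).symm⟩
      · rintro ⟨u, hu⟩
        constructor
        · intro h0
          have h0' : q u = 0 := congrArg Subtype.val h0
          obtain ⟨v, hv⟩ := (hq0 u).mp h0'
          refine ⟨⟨π n v, v, rfl⟩, Subtype.ext ?_⟩
          change l • π n v = u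
          rw [← hlx, ← hv]
          obtain ⟨w, rfl⟩ := hu
          exact hπ _ _
        · rintro ⟨v, hv⟩
          apply Subtype.ext
          change q u = 0
          rw [hq0]
          exact ⟨v, (congrArg Subtype.val hv).symm⟩
    have hfin : ∀ n, Module.length A (LinearMap.range (ϖ n)) ≠ ⊤ := by
      intro n htop
      have := hlen' (n - 1)
      rw [sub_add_cancel, htop, add_top, ← hh] at this
      exact ENat.natCast_ne_top _ this
    let h' : ℤ → ℕ := fun n => (Module.length A (LinearMap.range (ϖ n))).toNat
    have hh' : ∀ n, (h' n : ℕ∞) = Module.length A (LinearMap.range (ϖ n)) :=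
      fun n => ENat.natCast_toNat (hfin n)
    have key := ih (QuotSMulTop l M) rs.dropLast (by simp [hlen])
      (fun r hr => hI r (List.mem_of_mem_dropLast hr)) hl2 ϖ
      (by
        intro n u
        obtain ⟨u, rfl⟩ := hq u
        rw [hϖ, hϖ, hπ])
      (by
        intro n i u
        obtain ⟨u, rfl⟩ := hq u
        rw [← hqR, hϖ, hϖ, hx, hqR])
      h' hh' (n + 1)
    rw [Function.iterate_succ_apply]
    rw [← delta_shift] at key
    convert key using 2
    funext n
    have h1 : h (n + 1) = h n + h' (n + 1) := by
      have := hlen' n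
      rw [← hh, ← hh, ← hh'] at this
      exact_mod_cast this
    simp [deltaOp, h1]

universe u v w

lemma exists_ext (A : Type u) [CommRing A] [IsArtinianRing A] [IsLocalRing A] :
    ∃ (A1 : Type u) (_ : CommRing A1) (_ : Algebra A A1) (_ : IsNoetherianRing A1)
      (_ : Module.Flat A A1) (c : ℕ → A1),
      (∀ (N : Type v) [AddCommGroup N] [Module A N],
        Module.length A1 (TensorProduct A A1 N) = Module.length A N) ∧
      ∀ i j, i ≠ j → IsUnit (c i - c j) := by
  let P : Ideal (Polynomial A) := (IsLocalRing.maximalIdeal A).map Polynomial.C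
  have hP : P.IsPrime := Ideal.isPrime_map_C_of_isPrime
  let A1 := Localization.AtPrime P
  have hmax : (IsLocalRing.maximalIdeal A).map (algebraMap A A1) = IsLocalRing.maximalIdeal A1 := by
    rw [← Localization.AtPrime.map_eq_maximalIdeal, IsScalarTower.algebraMap_eq A (Polynomial A) A1,
      ← Ideal.map_map]
    rfl
  have : Module.Flat (Polynomial A) A1 := IsLocalization.flat A1 P.primeCompl
  have : Module.Flat A A1 := Module.Flat.trans A (Polynomial A) A1
  have : IsNoetherianRing A1 := IsLocalization.isNoetherianRing P.primeCompl A1 inferInstance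
  have : IsLocalHom (algebraMap A A1) := by
    refine ((IsLocalRing.local_hom_TFAE (algebraMap A A1)).out 0 2).mpr ?_
    exact hmax.le
  refine ⟨A1, inferInstance, inferInstance, inferInstance, inferInstance,
    fun j => algebraMap (Polynomial A) A1 (Polynomial.X ^ j), ?_, ?_⟩
  · intro N _ _
    rw [IsLocalRing.length_baseChange A A1 N, hmax]
    have : IsSimpleModule A1 (A1 ⧸ IsLocalRing.maximalIdeal A1) :=
      isSimpleModule_iff_quot_maximal.mpr ⟨_, inferInstance, ⟨LinearEquiv.refl _ _⟩⟩
    rw [Module.length_eq_one A1 (A1 ⧸ IsLocalRing.maximalIdeal A1), mul_one]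
  · intro i j hij
    have : (Polynomial.X ^ i - Polynomial.X ^ j : Polynomial A) ∈ P.primeCompl := by
      intro hmem
      have := Ideal.mem_map_C_iff.mp hmem i
      rw [Polynomial.coeff_sub, Polynomial.coeff_X_pow, Polynomial.coeff_X_pow, if_pos rfl,
        if_neg hij, sub_zero] at this
      exact (Ideal.ne_top_iff_one _).mp (IsLocalRing.maximalIdeal.isMaximal A).ne_top this
    have h2 := IsLocalization.map_units A1 (⟨_, this⟩ : P.primeCompl)
    simpa using h2

lemma length_range_baseChange {A A1 N : Type*} [CommRing A] [CommRing A1] [Algebra A A1]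
    [Module.Flat A A1] [AddCommGroup N] [Module A N] (f : N →ₗ[A] N) :
    Module.length A1 (LinearMap.range (f.baseChange A1)) =
      Module.length A1 (TensorProduct A A1 (LinearMap.range f)) := by
  have h0 : f = (LinearMap.range f).subtype ∘ₗ f.rangeRestrict := rfl
  have h1 : LinearMap.range (f.baseChange A1) =
      LinearMap.range ((LinearMap.range f).subtype.baseChange A1) := by
    conv_lhs => rw [h0, LinearMap.baseChange_comp]
    refine LinearMap.range_comp_of_range_eq_top _ (LinearMap.range_eq_top.mpr ?_)
    exact LinearMap.lTensor_surjective A1 f.surjective_rangeRestrict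
  have h2 : Function.Injective ((LinearMap.range f).subtype.baseChange A1) :=
    Module.Flat.lTensor_preserves_injective_linearMap (M := A1) (LinearMap.range f).subtype
      (LinearMap.range f).injective_subtype
  rw [h1]
  exact (LinearEquiv.ofInjective _ h2).length_eq.symm

open TensorProduct in
attribute [local instance] Algebra.TensorProduct.rightAlgebra in
lemma delta_nonneg_local {A : Type u} {R : Type v} {M : Type w} [CommRing A] [IsArtinianRing A]
    [IsLocalRing A]
    [CommRing R] [Algebra A R] [Algebra.FiniteType A R]
    [AddCommGroup M] [Module A M] [Module R M] [IsScalarTower A R M] [Module.Finite R M]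
    {m : ℕ} (x : Fin m → R) (rs : List R)
    (hrs : ∀ r ∈ rs, r ∈ (Ideal.span (Set.range x)).radical) (hreg : IsWeaklyRegular M rs)
    (π : ℤ → M →ₗ[A] M) (hπ : ∀ n u, π n (π n u) = π n u)
    (hx : ∀ n i u, π (n + 1) (x i • u) = x i • π n u)
    (h : ℤ → ℕ) (hh : ∀ n, (h n : ℕ∞) = Module.length A (LinearMap.range (π n))) (n : ℤ) :
    0 ≤ deltaOp^[rs.length] (fun n => (h n : ℚ)) n := by
  obtain ⟨A1, _, _, _, _, c, hlen, hc⟩ := exists_ext.{u, w} A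
  have : IsNoetherianRing (A1 ⊗[A] R) := Algebra.FiniteType.isNoetherianRing A1 _
  have : Module.Flat R (A1 ⊗[A] R) := by
    have hpo : Algebra.IsPushout A R A1 (A1 ⊗[A] R) := Algebra.IsPushout.symm inferInstance
    exact Module.Flat.isBaseChange A R A1 _ hpo.out
  have hwr : IsWeaklyRegular ((A1 ⊗[A] R) ⊗[R] M) (rs.map (algebraMap R (A1 ⊗[A] R))) :=
    hreg.of_flat_of_isBaseChange (TensorProduct.isBaseChange R M (A1 ⊗[A] R))
  let e : (A1 ⊗[A] R) ⊗[R] M ≃ₗ[A1] A1 ⊗[A] M :=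
    Algebra.IsPushout.cancelBaseChange A A1 R (A1 ⊗[A] R) M
  let π1 : ℤ → ((A1 ⊗[A] R) ⊗[R] M →ₗ[A1] (A1 ⊗[A] R) ⊗[R] M) := fun n =>
    e.symm.toLinearMap ∘ₗ (π n).baseChange A1 ∘ₗ e.toLinearMap
  have hx1 : ∀ (r : R) u, e (algebraMap R (A1 ⊗[A] R) r • u) =
      ((Algebra.lsmul A A M r).baseChange A1) (e u) := by
    intro r u
    obtain ⟨v, rfl⟩ := e.symm.surjective u
    rw [LinearEquiv.apply_symm_apply]
    induction v with
    | zero => simp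
    | add a b ha hb => rw [map_add, smul_add, map_add, ha, hb, map_add]
    | tmul a b =>
      rw [← LinearEquiv.eq_symm_apply]
      simp only [e, LinearMap.baseChange_tmul, Algebra.IsPushout.cancelBaseChange_symm_tmul,
        Algebra.lsmul_coe]
      rw [← TensorProduct.smul_tmul, TensorProduct.smul_tmul', smul_eq_mul, Algebra.smul_def]
  have key := delta_nonneg (fun i => algebraMap R (A1 ⊗[A] R) (x i)) c hc rs.length
    ((A1 ⊗[A] R) ⊗[R] M) (rs.map (algebraMap R (A1 ⊗[A] R))) (by simp)
    (by
      intro r hr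
      obtain ⟨s, hs, rfl⟩ := List.mem_map.mp hr
      have : s ∈ ((Ideal.span (Set.range x)).radical) := hrs s hs
      obtain ⟨k, hk⟩ := this
      refine ⟨k, ?_⟩
      rw [← map_pow]
      have := Ideal.mem_map_of_mem (algebraMap R (A1 ⊗[A] R)) hk
      rw [Ideal.map_span, ← Set.range_comp] at this
      exact this)
    hwr π1
    (by
      intro n u
      simp only [π1, LinearMap.comp_apply, LinearEquiv.coe_coe, LinearEquiv.apply_symm_apply]
      congr 1
      rw [← LinearMap.comp_apply, ← LinearMap.baseChange_comp]
      congr 2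
      exact LinearMap.ext (hπ n))
    (by
      intro n i u
      simp only [π1, LinearMap.comp_apply, LinearEquiv.coe_coe]
      rw [LinearEquiv.symm_apply_eq, hx1, hx1, LinearEquiv.apply_symm_apply,
        ← LinearMap.comp_apply, ← LinearMap.comp_apply, ← LinearMap.baseChange_comp,
        ← LinearMap.baseChange_comp]
      congr 2
      exact LinearMap.ext (hx n i))
    h
    (by
      intro n
      rw [hh, ← hlen, ← length_range_baseChange]
      refine LinearEquiv.length_eq (LinearEquiv.ofSubmodules e.symm _ _ ?_)
      simp only [π1]
      rw [LinearMap.range_comp, LinearMap.range_comp_of_range_eq_top _ e.range])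
    n
  exact key

lemma finite_of_supportDim_le_zero {A R M : Type*} [CommRing A] [IsArtinianRing A] [CommRing R]
    [Algebra A R] [Algebra.FiniteType A R] [AddCommGroup M] [Module A M] [Module R M]
    [IsScalarTower A R M] [Module.Finite R M] (h : Module.supportDim R M ≤ 0) :
    Module.Finite A M := by
  rw [Module.supportDim_eq_ringKrullDim_quotient_annihilator] at h
  have h1 : Ring.KrullDimLE 0 (R ⧸ Module.annihilator R M) := by
    rw [Ring.krullDimLE_iff]; exact_mod_cast h
  have h2 : Module.Finite A (R ⧸ Module.annihilator R M) :=
    (Module.finite_iff_krullDimLE_zero _ _).mpr h1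
  obtain ⟨s, hs⟩ := (Module.finite_def (R := R) (M := M)).mp inferInstance
  have hz : ∀ g : M, Module.annihilator R M ≤ LinearMap.ker (LinearMap.toSpanSingleton R M g) := by
    intro g r hr
    rw [LinearMap.mem_ker, LinearMap.toSpanSingleton_apply]
    exact Module.mem_annihilator.mp hr g
  classical
  let φ : (s → (R ⧸ Module.annihilator R M)) →ₗ[R] M :=
    LinearMap.lsum R (fun _ => R ⧸ Module.annihilator R M) R
      (fun g => (Module.annihilator R M).liftQ (LinearMap.toSpanSingleton R M g) (hz g))
  have hφ : Function.Surjective φ := by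
    rw [← LinearMap.range_eq_top, eq_top_iff, ← hs, Submodule.span_le]
    intro g hg
    refine ⟨Pi.single ⟨g, hg⟩ (Submodule.Quotient.mk 1), ?_⟩
    simp only [φ, LinearMap.lsum_piSingle, Submodule.liftQ_apply]
    simp
  exact Module.Finite.of_surjective (φ.restrictScalars A) hφ

lemma finite_quot {A R M : Type*} [CommRing A] [CommRing R]
    [Algebra A R] [AddCommGroup M] [Module A M] [Module R M]
    [IsScalarTower A R M] [Module.Finite A M] (U : Submodule R M) : Module.Finite A (M ⧸ U) :=
  Module.Finite.of_surjective (U.mkQ.restrictScalars A) U.mkQ_surjective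

lemma length_quot_ne_top {A R : Type*} [CommRing A] [IsArtinianRing A] [CommRing R]
    [Algebra A R] [Algebra.FiniteType A R] (rs : List R) :
    ∀ (M : Type*) [AddCommGroup M] [Module A M] [Module R M]
    [IsScalarTower A R M] [Module.Finite R M], IsWeaklyRegular M rs →
    Module.supportDim R M ≤ rs.length →
    Module.length A (M ⧸ (Ideal.ofList rs • ⊤ : Submodule R M)) ≠ ⊤ := by
  induction rs with
  | nil =>
    intro M _ _ _ _ _ _ h
    have := finite_of_supportDim_le_zero (A := A) (by simpa using h)
    have : Module.Finite A (M ⧸ (Ideal.ofList ([] : List R) • ⊤ : Submodule R M)) :=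
      finite_quot _
    exact Module.length_ne_top
  | cons r rs ih =>
    intro M _ _ _ _ _ hreg h
    rw [isWeaklyRegular_cons_iff] at hreg
    have hN : IsNoetherianRing R := Algebra.FiniteType.isNoetherianRing A R
    have h1 : Module.supportDim R (QuotSMulTop r M) + 1 ≤ Module.supportDim R M :=
      Module.supportDim_quotSMulTop_succ_le_of_notMem_minimalPrimes
        (fun p hp => hreg.1.notMem_of_mem_minimalPrimes hp)
    have h2 : Module.supportDim R (QuotSMulTop r M) ≤ rs.length := by
      have h3 := h1.trans h
      rw [List.length_cons] at h3
      generalize Module.supportDim R (QuotSMulTop r M) = z at h3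
      cases z with
      | bot => exact bot_le
      | coe z =>
        have h4 : z + 1 ≤ (rs.length : ℕ∞) + 1 := by exact_mod_cast h3
        have h5 : z ≤ (rs.length : ℕ∞) := by
          exact (ENat.add_le_add_iff_right (by simp)).mp h4
        exact_mod_cast h5
    have := ih (QuotSMulTop r M) hreg.2 h2
    rwa [((Submodule.quotOfListConsSMulTopEquivQuotSMulTopInner M r rs).restrictScalars A).length_eq]

lemma length_le_add_of_exact {A X Y Z : Type*} [CommRing A] [AddCommGroup X] [Module A X]
    [AddCommGroup Y] [Module A Y] [AddCommGroup Z] [Module A Z] (f : X →ₗ[A] Y) (g : Y →ₗ[A] Z)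
    (h : LinearMap.ker g ≤ LinearMap.range f) :
    Module.length A Y ≤ Module.length A X + Module.length A Z := by
  rw [Module.length_eq_add_of_exact (LinearMap.ker g).subtype g.rangeRestrict
    (Submodule.subtype_injective _) g.surjective_rangeRestrict
    (by rw [LinearMap.exact_iff]; simp)]
  refine add_le_add ?_ (Module.length_le_of_injective _ (Submodule.subtype_injective _))
  exact (Module.length_le_of_injective _ (Submodule.inclusion_injective h)).trans
    (Module.length_le_of_surjective f.rangeRestrict f.surjective_rangeRestrict)

lemma length_pow_le {A R M : Type*} [CommRing A] [CommRing R]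
    [Algebra A R] [AddCommGroup M] [Module A M] [Module R M]
    [IsScalarTower A R M] (r : R) (U : Submodule R M) (k : ℕ) :
    Module.length A (M ⧸ (r ^ k • (⊤ : Submodule R M) ⊔ U)) ≤
      k * Module.length A (M ⧸ (r • (⊤ : Submodule R M) ⊔ U)) := by
  induction k with
  | zero =>
    have : Subsingleton (M ⧸ (r ^ 0 • (⊤ : Submodule R M) ⊔ U)) := by
      rw [Submodule.Quotient.subsingleton_iff]; simp
    simp
  | succ k ih =>
    have hle : (r • (⊤ : Submodule R M) ⊔ U) ≤
        (r ^ (k + 1) • (⊤ : Submodule R M) ⊔ U).comap (LinearMap.lsmul R M (r ^ k)) := by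
      refine sup_le ?_ ?_
      · intro u hu
        obtain ⟨v, -, rfl⟩ := (Submodule.mem_smul_pointwise_iff_exists _ _ _).mp hu
        refine Submodule.mem_sup_left ?_
        rw [LinearMap.lsmul_apply, ← mul_smul, ← pow_succ]
        exact Submodule.smul_mem_pointwise_smul _ _ _ trivial
      · intro u hu
        exact Submodule.mem_sup_right (U.smul_mem _ hu)
    have hle2 : (r ^ (k + 1) • (⊤ : Submodule R M) ⊔ U) ≤ (r ^ k • (⊤ : Submodule R M) ⊔ U) := by
      refine sup_le ?_ le_sup_right
      intro u hu
      obtain ⟨v, -, rfl⟩ := (Submodule.mem_smul_pointwise_iff_exists _ _ _).mp hu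
      refine Submodule.mem_sup_left ?_
      rw [pow_succ, mul_smul]
      exact Submodule.smul_mem_pointwise_smul _ _ _ trivial
    have := length_le_add_of_exact
      ((Submodule.mapQ _ _ (LinearMap.lsmul R M (r ^ k)) hle).restrictScalars A)
      ((Submodule.factor hle2).restrictScalars A) (by
        intro y hy
        obtain ⟨u, rfl⟩ := Submodule.mkQ_surjective _ y
        have h0 : Submodule.Quotient.mk (p := (r ^ k • (⊤ : Submodule R M) ⊔ U)) u = 0 := hy
        rw [Submodule.Quotient.mk_eq_zero, Submodule.mem_sup] at h0
        obtain ⟨a, ha, b, hb, rfl⟩ := h0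
        obtain ⟨v, -, rfl⟩ := (Submodule.mem_smul_pointwise_iff_exists _ _ _).mp ha
        refine ⟨Submodule.Quotient.mk v, ?_⟩
        change Submodule.Quotient.mk (r ^ k • v) = Submodule.Quotient.mk _
        rw [Submodule.Quotient.eq]
        simpa using Submodule.mem_sup_right hb)
    refine this.trans ?_
    push_cast
    rw [add_mul, one_mul, add_comm]
    exact add_le_add_left ih _

lemma length_list_pow_le {A R M : Type*} [CommRing A] [CommRing R]
    [Algebra A R] [AddCommGroup M] [Module A M] [Module R M]
    [IsScalarTower A R M] (k : ℕ) (rs : List R) : ∀ (U : Submodule R M),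
    Module.length A (M ⧸ (Ideal.ofList (rs.map (· ^ k)) • (⊤ : Submodule R M) ⊔ U)) ≤
      (k ^ rs.length : ℕ) * Module.length A (M ⧸ (Ideal.ofList rs • (⊤ : Submodule R M) ⊔ U)) := by
  induction rs with
  | nil =>
    intro U
    refine le_of_eq ?_
    rw [List.length_nil, pow_zero, Nat.cast_one, one_mul]
    rfl
  | cons r rs ih =>
    intro U
    rw [List.map_cons, Ideal.ofList_cons_smul, Ideal.ofList_cons_smul]
    have e1 : (r ^ k • (⊤ : Submodule R M) ⊔ Ideal.ofList (rs.map (· ^ k)) • ⊤) ⊔ U =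
      Ideal.ofList (rs.map (· ^ k)) • ⊤ ⊔ (r ^ k • ⊤ ⊔ U) := by
      rw [sup_comm (r ^ k • ⊤), sup_assoc]
    have e2 : (r • (⊤ : Submodule R M) ⊔ Ideal.ofList rs • ⊤) ⊔ U =
      r • ⊤ ⊔ (Ideal.ofList rs • ⊤ ⊔ U) := sup_assoc _ _ _
    have e3 : Ideal.ofList rs • (⊤ : Submodule R M) ⊔ (r ^ k • ⊤ ⊔ U) =
      r ^ k • ⊤ ⊔ (Ideal.ofList rs • ⊤ ⊔ U) := sup_left_comm _ _ _
    rw [e1, e2]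
    refine (ih _).trans ?_
    rw [e3, List.length_cons, pow_succ, Nat.cast_mul, mul_assoc]
    gcongr
    exact length_pow_le r _ k

/-- Elements all of whose components in degrees below `j` vanish. -/
def filt {A R M : Type*} [CommRing A] [CommRing R]
    [Algebra A R] [AddCommGroup M] [Module A M] [Module R M]
    [IsScalarTower A R M] (S : Set R) (hS : Algebra.adjoin A S = ⊤) (π : ℤ → M →ₗ[A] M)
    (hx : ∀ r ∈ S, ∀ n u, π (n + 1) (r • u) = r • π n u) (j : ℤ) : Submodule R M where
  carrier := {u | ∀ n < j, π n u = 0}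
  add_mem' := by
    intro a b ha hb n hn
    rw [map_add, ha n hn, hb n hn, add_zero]
  zero_mem' := fun n _ => map_zero _
  smul_mem' := by
    intro r
    have hr : r ∈ Algebra.adjoin A S := by rw [hS]; trivial
    induction hr using Algebra.adjoin_induction with
    | mem s hs =>
      intro u hu n hn
      have := hx s hs (n - 1) u
      rw [sub_add_cancel] at this
      rw [this, hu (n - 1) (by omega), smul_zero]
    | algebraMap a =>
      intro u hu n hn
      rw [algebraMap_smul, map_smul, hu n hn, smul_zero]
    | add a b _ _ ha hb =>
      intro u hu n hn
      rw [add_smul, map_add, ha hu n hn, hb hu n hn, add_zero]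
    | mul a b _ _ ha hb =>
      intro u hu n hn
      rw [mul_smul]
      exact ha (hb hu) n hn

section
variable {A R M : Type*} [CommRing A] [CommRing R]
    [Algebra A R] [AddCommGroup M] [Module A M] [Module R M]
    [IsScalarTower A R M] (S : Set R) (hS : Algebra.adjoin A S = ⊤) (π : ℤ → M →ₗ[A] M)
    (hx : ∀ r ∈ S, ∀ n u, π (n + 1) (r • u) = r • π n u)

lemma span_smul_filt (j : ℤ) : Ideal.span S • filt S hS π hx j ≤ filt S hS π hx (j + 1) := by
  rw [Submodule.smul_le]
  intro r hr u hu
  induction hr using Submodule.span_induction with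
  | mem s hs =>
    intro n hn
    have := hx s hs (n - 1) u
    rw [sub_add_cancel] at this
    rw [this, hu (n - 1) (by omega), smul_zero]
  | zero => rw [zero_smul]; exact zero_mem _
  | add a b _ _ ha hb => rw [add_smul]; exact add_mem ha hb
  | smul a b _ hb => rw [smul_assoc]; exact Submodule.smul_mem _ _ hb

lemma span_pow_smul_filt (j : ℤ) (k : ℕ) :
    Ideal.span S ^ k • filt S hS π hx j ≤ filt S hS π hx (j + k) := by
  induction k with
  | zero => simp
  | succ k ih =>
    rw [pow_succ', mul_smul]
    refine (Submodule.smul_mono le_rfl ih).trans ?_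
    refine (span_smul_filt S hS π hx _).trans (le_of_eq ?_)
    push_cast
    rw [add_assoc]

lemma exists_filt_top [Module.Finite R M] (hfin : ∀ u : M, ∃ j : ℤ, ∀ n < j, π n u = 0) :
    ∃ j : ℤ, filt S hS π hx j = ⊤ := by
  obtain ⟨s, hs⟩ := (Module.finite_def (R := R) (M := M)).mp inferInstance
  choose f hf using hfin
  obtain ⟨j, hj⟩ : ∃ j : ℤ, ∀ g ∈ s, j ≤ f g := by
    obtain ⟨j, hj⟩ := (s.finite_toSet.image f).bddBelow
    exact ⟨j, fun g hg => hj ⟨g, hg, rfl⟩⟩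
  refine ⟨j, ?_⟩
  rw [eq_top_iff, ← hs, Submodule.span_le]
  intro g hg n hn
  exact hf g n (lt_of_lt_of_le hn (hj g hg))

lemma sum_length_le (hπ : ∀ n u, π n (π n u) = π n u) (hπ' : ∀ a b u, a ≠ b → π a (π b u) = 0)
    (j : ℤ) (hj : filt S hS π hx j = ⊤) (k : ℕ) :
    ∑ i : Fin k, Module.length A (LinearMap.range (π (j + (i : ℕ)))) ≤
      Module.length A (M ⧸ (Ideal.span S ^ k • (⊤ : Submodule R M))) := by
  rw [← Module.length_pi_of_fintype]
  let U : Submodule A M := (Ideal.span S ^ k • (⊤ : Submodule R M)).restrictScalars A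
  let φ : M →ₗ[A] (∀ i : Fin k, LinearMap.range (π (j + (i : ℕ)))) :=
    LinearMap.pi fun i => (π (j + (i : ℕ))).rangeRestrict
  have hφ : Function.Surjective φ := by
    intro y
    refine ⟨∑ i, (y i : M), ?_⟩
    funext i
    apply Subtype.ext
    change π (j + (i : ℕ)) (∑ i, (y i : M)) = y i
    rw [map_sum, Finset.sum_eq_single i]
    · obtain ⟨u, hu⟩ := (y i).2
      rw [← hu, hπ]
    · intro b _ hb
      obtain ⟨u, hu⟩ := (y b).2
      rw [← hu]
      refine hπ' _ _ _ ?_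
      intro h
      apply hb
      apply Fin.ext
      omega
    · simp
  have hU : U ≤ LinearMap.ker φ := by
    intro u hu
    have h1 : u ∈ filt S hS π hx (j + k) := by
      refine span_pow_smul_filt S hS π hx j k ?_
      rw [hj]
      exact hu
    rw [LinearMap.mem_ker]
    funext i
    apply Subtype.ext
    exact h1 _ (by have := i.2; omega)
  have e : Module.length A (M ⧸ U) = Module.length A (M ⧸ (Ideal.span S ^ k • (⊤ : Submodule R M))) :=
    ((Submodule.Quotient.restrictScalarsEquiv A (Ideal.span S ^ k • (⊤ : Submodule R M)))).length_eq
  rw [← e]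
  refine Module.length_le_of_surjective (U.liftQ φ hU) ?_
  intro y
  obtain ⟨u, rfl⟩ := hφ y
  exact ⟨Submodule.Quotient.mk u, rfl⟩

end

lemma sum_bound {A R M : Type*} [CommRing A] [IsArtinianRing A] [CommRing R]
    [Algebra A R] [Algebra.FiniteType A R] [AddCommGroup M] [Module A M] [Module R M]
    [IsScalarTower A R M] [Module.Finite R M] (S : Set R) (hS : Algebra.adjoin A S = ⊤)
    (π : ℤ → M →ₗ[A] M)
    (hx : ∀ r ∈ S, ∀ n u, π (n + 1) (r • u) = r • π n u)
    (hfin : ∀ u : M, ∃ j : ℤ, ∀ n < j, π n u = 0)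
    (hπ : ∀ n u, π n (π n u) = π n u) (hπ' : ∀ a b u, a ≠ b → π a (π b u) = 0)
    (rs : List R) (hrs : ∀ r ∈ rs, r ∈ (Ideal.span S).radical) (hreg : IsWeaklyRegular M rs)
    (hdim : Module.supportDim R M ≤ rs.length)
    (h : ℤ → ℕ) (hh : ∀ n, (h n : ℕ∞) = Module.length A (LinearMap.range (π n))) :
    ∃ (j : ℤ) (C : ℕ), ∀ k : ℕ, ∑ i ∈ Finset.range k, h (j + (i : ℕ)) ≤ C * k ^ rs.length := by
  have hN : IsNoetherianRing R := Algebra.FiniteType.isNoetherianRing A R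
  obtain ⟨j, hj⟩ := exists_filt_top S hS π hx hfin
  obtain ⟨c, hc⟩ := (Ideal.span S).exists_radical_pow_le_of_fg
    (Ideal.fg_of_isNoetherianRing _)
  have hL := length_quot_ne_top (A := A) rs M hreg hdim
  obtain ⟨L, hL⟩ := ENat.ne_top_iff_exists.mp hL
  refine ⟨j, c ^ rs.length * L, fun k => ?_⟩
  have h1 := sum_length_le S hS π hx hπ hπ' j hj k
  have h2 : Ideal.ofList (rs.map (· ^ (c * k))) • (⊤ : Submodule R M) ⊔ ⊥ ≤
      Ideal.span S ^ k • (⊤ : Submodule R M) := by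
    rw [sup_bot_eq]
    refine Submodule.smul_mono_left ?_
    refine Ideal.span_le.mpr ?_
    intro s hs
    obtain ⟨r, hr, rfl⟩ := List.mem_map.mp hs
    simp only [pow_mul, SetLike.mem_coe]
    exact Ideal.pow_mem_pow (hc (Ideal.pow_mem_pow (hrs r hr) c)) k
  have h3 := Module.length_le_of_surjective ((Submodule.factor h2).restrictScalars A)
    (Submodule.factor_surjective h2)
  have h4 := length_list_pow_le (A := A) (c * k) rs (⊥ : Submodule R M)
  have h5 : Module.length A (M ⧸ (Ideal.ofList rs • (⊤ : Submodule R M) ⊔ ⊥)) = L := by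
    rw [hL, sup_bot_eq]
  rw [h5] at h4
  have h6 := (h1.trans h3).trans h4
  simp only [← hh] at h6
  rw [Finset.sum_range]
  have h7 : ∑ i : Fin k, h (j + (i : ℕ)) ≤ (c * k) ^ rs.length * L := by exact_mod_cast h6
  refine h7.trans (le_of_eq ?_)
  ring

lemma degree_lt_of_sum_bound (P : Polynomial ℚ) (h : ℤ → ℕ) (N : ℤ)
    (hP : ∀ n : ℤ, N ≤ n → P.eval (n : ℚ) = h n) (d : ℕ) (j : ℤ) (C : ℕ)
    (hC : ∀ k : ℕ, ∑ i ∈ Finset.range k, h (j + (i : ℕ)) ≤ C * k ^ d) : P.degree < d := by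
  by_contra hcon
  push Not at hcon
  have hO := Polynomial.isBigO_atTop_of_degree_le (Polynomial.X ^ d : Polynomial ℚ) P
    (by rw [Polynomial.degree_X_pow]; exact hcon)
  obtain ⟨c, hcpos, hc⟩ := hO.exists_pos
  obtain ⟨B, hB⟩ := Filter.eventually_atTop.mp hc.bound
  obtain ⟨t0, ht0⟩ : ∃ t0 : ℕ, B ≤ t0 ∧ N ≤ t0 := by
    obtain ⟨a, ha⟩ := exists_nat_ge B
    refine ⟨a + N.toNat, ?_, ?_⟩
    · push_cast
      have : (0 : ℚ) ≤ N.toNat := by positivity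
      linarith
    · push_cast; omega
  have hc' : ∀ n : ℤ, (t0 : ℤ) ≤ n → (n : ℝ) ^ d ≤ c * h n := by
    intro n hn
    have hn' : (t0 : ℚ) ≤ n := by exact_mod_cast hn
    have := hB n (ht0.1.trans hn')
    rw [hP n (ht0.2.trans hn)] at this
    simp only [Polynomial.eval_pow, Polynomial.eval_X] at this
    rw [← Rat.norm_cast_real, ← Rat.norm_cast_real] at this
    push_cast at this
    rw [Real.norm_of_nonneg (by positivity : (0 : ℝ) ≤ (h n : ℝ))] at this
    exact (Real.le_norm_self _).trans this
  obtain ⟨s1, hs1⟩ := exists_nat_gt (c * C * 4 ^ d)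
  obtain ⟨s, hs⟩ : ∃ s : ℕ, s = s1 + t0 + j.natAbs + 1 := ⟨_, rfl⟩
  have hb := hC (4 * s)
  have hsub : ∑ i ∈ Finset.Ico (2 * s) (4 * s), h (j + (i : ℕ)) ≤
      ∑ i ∈ Finset.range (4 * s), h (j + (i : ℕ)) := by
    refine Finset.sum_le_sum_of_subset ?_
    intro i hi
    rw [Finset.mem_Ico] at hi
    exact Finset.mem_range.mpr hi.2
  have hlow : ∑ i ∈ Finset.Ico (2 * s) (4 * s), (s : ℝ) ^ d ≤
      ∑ i ∈ Finset.Ico (2 * s) (4 * s), c * (h (j + (i : ℕ)) : ℝ) := by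
    refine Finset.sum_le_sum ?_
    intro i hi
    rw [Finset.mem_Ico] at hi
    refine le_trans ?_ (hc' (j + (i : ℕ)) (by omega))
    have : (s : ℤ) ≤ j + (i : ℕ) := by omega
    have h2 : (s : ℝ) ≤ ((j + (i : ℕ) : ℤ) : ℝ) := by exact_mod_cast this
    exact pow_le_pow_left₀ (by positivity) h2 d
  rw [Finset.sum_const, Nat.card_Ico, ← Finset.mul_sum, nsmul_eq_mul] at hlow
  have hub : ((∑ i ∈ Finset.Ico (2 * s) (4 * s), h (j + (i : ℕ)) : ℕ) : ℝ) ≤ C * (4 * s) ^ d := by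
    exact_mod_cast hsub.trans hb
  push_cast at hub
  have hcard : ((4 * s - 2 * s : ℕ) : ℝ) = 2 * s := by
    have : 4 * s - 2 * s = 2 * s := by omega
    rw [this]; push_cast; rfl
  rw [hcard] at hlow
  have hspos : (0 : ℝ) < s := by rw [hs]; positivity
  have hfin := hlow.trans (mul_le_mul_of_nonneg_left hub hcpos.le)
  rw [mul_pow] at hfin
  have hpow : (0 : ℝ) < (s : ℝ) ^ d := by positivity
  have h9 : (2 * s : ℝ) ≤ c * C * 4 ^ d := by
    refine le_of_mul_le_mul_right ?_ hpow
    linarith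
  have h10 : (s1 : ℝ) ≤ s := by exact_mod_cast (by omega : s1 ≤ s)
  linarith

lemma delta_poly (P : Polynomial ℚ) (d : ℕ) (hP : P.degree < d) (n : ℤ) :
    deltaOp^[d] (fun n : ℤ => P.eval (n : ℚ)) n = 0 := by
  have h : ∀ (k : ℕ) (n : ℤ), deltaOp^[k] (fun n : ℤ => P.eval (n : ℚ)) n =
      (fwdDiff (1 : ℚ))^[k] (fun x => P.eval x) n := by
    intro k
    induction k with
    | zero => intro n; rfl
    | succ k ih =>
      intro n
      rw [Function.iterate_succ_apply', Function.iterate_succ_apply']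
      simp only [deltaOp, fwdDiff, ih]
      push_cast
      rfl
  rw [h]
  rcases eq_or_ne P 0 with rfl | h0
  · have e : (fun x : ℚ => (0 : Polynomial ℚ).eval x) = 0 := by funext x; simp
    rw [e]
    have : ∀ k : ℕ, (fwdDiff (1 : ℚ))^[k] (0 : ℚ → ℚ) = 0 := by
      intro k
      induction k with
      | zero => rfl
      | succ k ih => rw [Function.iterate_succ_apply', ih]; funext x; simp [fwdDiff]
    rw [this]; rfl
  rw [← Polynomial.natDegree_lt_iff_degree_lt h0] at hP
  have := Polynomial.fwdDiff_iter_eq_zero_of_degree_lt hP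
  rw [this]; rfl

lemma delta_sub (f g : ℤ → ℚ) (d : ℕ) :
    deltaOp^[d] (fun n => f n - g n) = fun n => deltaOp^[d] f n - deltaOp^[d] g n := by
  induction d generalizing f g with
  | zero => rfl
  | succ d ih =>
    rw [Function.iterate_succ_apply, Function.iterate_succ_apply, Function.iterate_succ_apply, ← ih]
    congr 1
    funext n
    simp only [deltaOp]
    ring

lemma delta_zero (f : ℤ → ℚ) (N : ℤ) (hf : ∀ n, N ≤ n → f n = 0) (d : ℕ) :
    ∀ n, N ≤ n → deltaOp^[d] f n = 0 := by
  induction d with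
  | zero => exact hf
  | succ d ih =>
    intro n hn
    rw [Function.iterate_succ_apply']
    simp only [deltaOp]
    rw [ih n hn, ih (n + 1) (by omega), sub_zero]

lemma sign_step (f : ℤ → ℚ) (N : ℤ) (hf : ∀ n, N ≤ n → f n = 0) (hd : ∀ n, 0 ≤ f (n + 1) - f n) :
    ∀ n, f n ≤ 0 := by
  have : ∀ (k : ℕ) (n : ℤ), N - k ≤ n → f n ≤ 0 := by
    intro k
    induction k with
    | zero => intro n hn; rw [hf n (by simpa using hn)]
    | succ k ih =>
      intro n hn
      have h1 := ih (n + 1) (by push_cast at hn; omega)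
      have h2 := hd n
      linarith
  intro n
  exact this (N - n).toNat n (by omega)

lemma sign_alt (f : ℤ → ℚ) (N : ℤ) (hf : ∀ n, N ≤ n → f n = 0) (d : ℕ)
    (hd : ∀ n, 0 ≤ deltaOp^[d] f n) (k i : ℕ) (hk : i + k = d) :
    ∀ n, 0 ≤ (-1 : ℚ) ^ k * deltaOp^[i] f n := by
  induction k generalizing i with
  | zero => intro n; simp only [add_zero] at hk; subst hk; simpa using hd n
  | succ k ih =>
    have h1 := ih (i + 1) (by omega)
    have h2 := sign_step (fun n => (-1 : ℚ) ^ k * deltaOp^[i] f n) N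
      (fun n hn => by simp only [delta_zero f N hf i n hn, mul_zero])
      (fun n => by
        have := h1 n
        rw [Function.iterate_succ_apply'] at this
        simp only [deltaOp] at this
        linarith)
    intro n
    have := h2 n
    rw [pow_succ]
    linarith

section
variable {A R M : Type*} [CommRing A] [CommRing R]
    [Algebra A R] [AddCommGroup M] [Module A M] [Module R M]
    [IsScalarTower A R M] (ℳ : ℤ → Submodule A M) [DirectSum.Decomposition ℳ]

/-- Projection onto the degree `n` component. -/
def proj (n : ℤ) : M →ₗ[A] M :=
  (ℳ n).subtype ∘ₗ DirectSum.component A ℤ (fun i => ℳ i) n ∘ₗ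
    (DirectSum.decomposeLinearEquiv ℳ).toLinearMap

lemma proj_apply (n : ℤ) (u : M) : proj ℳ n u = (DirectSum.decompose ℳ u n : M) := rfl

lemma proj_mem (n : ℤ) (u : M) : proj ℳ n u ∈ ℳ n := (DirectSum.decompose ℳ u n).2

lemma proj_same {n : ℤ} {u : M} (hu : u ∈ ℳ n) : proj ℳ n u = u :=
  DirectSum.decompose_of_mem_same ℳ hu

lemma proj_ne {a b : ℤ} {u : M} (hu : u ∈ ℳ a) (hab : a ≠ b) : proj ℳ b u = 0 :=
  DirectSum.decompose_of_mem_ne ℳ hu hab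

lemma range_proj (n : ℤ) : LinearMap.range (proj ℳ n) = ℳ n := by
  apply le_antisymm
  · rintro _ ⟨u, rfl⟩; exact proj_mem ℳ n u
  · intro u hu; exact ⟨u, proj_same ℳ hu⟩

lemma proj_smul (r : R) (hr : ∀ n : ℤ, ∀ u ∈ ℳ n, r • u ∈ ℳ (n + 1)) (n : ℤ) (u : M) :
    proj ℳ (n + 1) (r • u) = r • proj ℳ n u := by
  induction u using DirectSum.Decomposition.inductionOn ℳ with
  | zero => simp
  | @homogeneous k u =>
    by_cases h : k = n
    · subst h
      rw [proj_same ℳ u.2, proj_same ℳ (hr _ _ u.2)]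
    · rw [proj_ne ℳ u.2 h, proj_ne ℳ (hr _ _ u.2) (by omega), smul_zero]
  | add a b ha hb => rw [smul_add, map_add, map_add, ha, hb, smul_add]

lemma proj_bdd (u : M) : ∃ j : ℤ, ∀ n < j, proj ℳ n u = 0 := by
  induction u using DirectSum.Decomposition.inductionOn ℳ with
  | zero => exact ⟨0, fun n _ => map_zero _⟩
  | @homogeneous k u => exact ⟨k, fun n hn => proj_ne ℳ u.2 (by omega)⟩
  | add a b ha hb =>
    obtain ⟨j, hj⟩ := ha
    obtain ⟨k, hk⟩ := hb
    refine ⟨min j k, fun n hn => ?_⟩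
    rw [map_add, hj n (by omega), hk n (by omega), add_zero]

end

lemma pos_mem_span {A R : Type*} [CommRing A] [CommRing R] [Algebra A R]
    (𝒜 : ℕ → Submodule A R) [GradedAlgebra 𝒜]
    (hstd : Algebra.adjoin A (𝒜 1 : Set R) = ⊤) (i : ℕ) (hi : 0 < i) (r : R) (hr : r ∈ 𝒜 i) :
    r ∈ Ideal.span (𝒜 1 : Set R) := by
  have key : ∀ r : R, ∃ a : A, r - algebraMap A R a ∈ Ideal.span (𝒜 1 : Set R) := by
    intro r
    have hr : r ∈ Algebra.adjoin A (𝒜 1 : Set R) := by rw [hstd]; trivial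
    induction hr using Algebra.adjoin_induction with
    | mem s hs => exact ⟨0, by simpa using Ideal.subset_span hs⟩
    | algebraMap a => exact ⟨a, by simp⟩
    | add x y _ _ hx hy =>
      obtain ⟨a, ha⟩ := hx
      obtain ⟨b, hb⟩ := hy
      refine ⟨a + b, ?_⟩
      have := add_mem ha hb
      rw [map_add]
      convert this using 1
      ring
    | mul x y _ _ hx hy =>
      obtain ⟨a, ha⟩ := hx
      obtain ⟨b, hb⟩ := hy
      refine ⟨a * b, ?_⟩
      have := add_mem (Ideal.mul_mem_left _ x hb) (Ideal.mul_mem_right (algebraMap A R b) _ ha)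
      rw [map_mul]
      convert this using 1
      ring
  obtain ⟨a, ha⟩ := key r
  have hle : Ideal.span (𝒜 1 : Set R) ≤ (HomogeneousIdeal.irrelevant 𝒜).toIdeal := by
    rw [Ideal.span_le]
    intro s hs
    change s ∈ HomogeneousIdeal.irrelevant 𝒜
    rw [HomogeneousIdeal.mem_irrelevant_iff, GradedRing.proj_apply]
    exact DirectSum.decompose_of_mem_ne 𝒜 hs (by norm_num)
  have h0 := hle ha
  change _ ∈ HomogeneousIdeal.irrelevant 𝒜 at h0
  rw [HomogeneousIdeal.mem_irrelevant_iff, map_sub, GradedRing.proj_apply, GradedRing.proj_apply,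
    DirectSum.decompose_of_mem_ne 𝒜 hr (by omega),
    DirectSum.decompose_of_mem_same 𝒜 (SetLike.algebraMap_mem_graded 𝒜 a), zero_sub,
    neg_eq_zero] at h0
  rwa [h0, sub_zero] at ha

lemma max_le_radical {A R : Type*} [CommRing A] [IsArtinianRing A] [IsLocalRing A] [CommRing R]
    [Algebra A R] (𝒜 : ℕ → Submodule A R) [GradedAlgebra 𝒜]
    (hstd : Algebra.adjoin A (𝒜 1 : Set R) = ⊤) :
    Ideal.span ((algebraMap A R) '' (IsLocalRing.maximalIdeal A : Set A) ∪
          ⋃ i ∈ Set.Ioi (0 : ℕ), (𝒜 i : Set R)) ≤ (Ideal.span (𝒜 1 : Set R)).radical := by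
  rw [Ideal.span_le]
  rintro r (⟨a, ha, rfl⟩ | hr)
  · have : IsNilpotent a := by
      have h := IsArtinianRing.isNilpotent_jacobson_bot (R := A)
      rw [IsLocalRing.jacobson_eq_maximalIdeal ⊥ bot_ne_top] at h
      obtain ⟨k, hk⟩ := h
      refine ⟨k, ?_⟩
      have := Ideal.pow_mem_pow ha k
      rw [hk] at this
      simpa using this
    obtain ⟨k, hk⟩ := this
    exact ⟨k, by rw [← map_pow, hk, map_zero]; exact zero_mem _⟩
  · simp only [Set.mem_iUnion] at hr
    obtain ⟨i, hi, hr⟩ := hr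
    exact Ideal.le_radical (pos_mem_span 𝒜 hstd i hi r hr)

end Marley

/-- **Marley's theorem for graded Cohen–Macaulay modules.**
Let `A` be an Artinian local ring, `R` a standard `ℕ`-graded finitely generated `A`-algebra
(with grading `𝒜`, generated in degree one), and `M` a finitely generated `ℤ`-graded
Cohen–Macaulay `R`-module of dimension `d` (Cohen–Macaulayness being encoded by the
existence of an `M`-regular sequence of length `d = dim M` inside the graded maximal ideal).
Let `hM` be the Hilbert function of `M` (the length of the graded pieces) and `P` its
Hilbert polynomial. Then `(-1)^(d-i) · Δ^i(hM - P)(n) ≥ 0` for all `0 ≤ i ≤ d`, `n ∈ ℤ`. -/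
theorem marley_difference_nonneg
    {A R M : Type*} [CommRing A] [IsArtinianRing A] [IsLocalRing A]
    [CommRing R] [Algebra A R] [Algebra.FiniteType A R]
    (𝒜 : ℕ → Submodule A R) [GradedAlgebra 𝒜]
    (hstd : Algebra.adjoin A (𝒜 1 : Set R) = ⊤)
    [AddCommGroup M] [Module A M] [Module R M] [IsScalarTower A R M] [Module.Finite R M]
    (ℳ : ℤ → Submodule A M) [DirectSum.Decomposition ℳ]
    (hcompat : ∀ (i : ℕ) (n : ℤ), ∀ r ∈ 𝒜 i, ∀ m ∈ ℳ n, r • m ∈ ℳ (n + i))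
    (d : ℕ)
    (hdim : ringKrullDim (R ⧸ Module.annihilator R M) = d)
    (hCM : ∃ rs : List R, rs.length = d ∧
      (∀ r ∈ rs, r ∈ Ideal.span
        ((algebraMap A R) '' (IsLocalRing.maximalIdeal A : Set A) ∪
          ⋃ i ∈ Set.Ioi (0 : ℕ), (𝒜 i : Set R))) ∧
      RingTheory.Sequence.IsRegular M rs)
    (hM : ℤ → ℕ)
    (hHilb : ∀ n : ℤ, (hM n : WithBot ℕ∞) = Order.krullDim (Submodule A (ℳ n)))
    (P : Polynomial ℚ)
    (hP : ∃ N : ℤ, ∀ n : ℤ, N ≤ n → P.eval (n : ℚ) = hM n)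
    (i : ℕ) (hi : i ≤ d) (n : ℤ) :
    0 ≤ (-1 : ℚ) ^ (d - i) *
      (deltaOp^[i] (fun n : ℤ => (hM n : ℚ) - P.eval (n : ℚ))) n := by
  obtain ⟨rs, hlen, hmem, hreg⟩ := hCM
  obtain ⟨N, hN⟩ := hP
  have hNoeth : IsNoetherianRing R := Algebra.FiniteType.isNoetherianRing A R
  have hrad : ∀ r ∈ rs, r ∈ (Ideal.span (𝒜 1 : Set R)).radical :=
    fun r hr => Marley.max_le_radical 𝒜 hstd (hmem r hr)
  have hwr := hreg.toIsWeaklyRegular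
  have hdeg1 : ∀ r ∈ (𝒜 1 : Set R), ∀ n u,
      Marley.proj ℳ (n + 1) (r • u) = r • Marley.proj ℳ n u :=
    fun r hr n u => Marley.proj_smul ℳ r
      (fun k v hv => by simpa using hcompat 1 k r hr v hv) n u
  have hlength : ∀ n, (hM n : ℕ∞) = Module.length A (LinearMap.range (Marley.proj ℳ n)) := by
    intro n
    rw [Marley.range_proj]
    have := hHilb n
    rw [← Module.coe_length] at this
    exact_mod_cast this
  have hidem : ∀ n u, Marley.proj ℳ n (Marley.proj ℳ n u) = Marley.proj ℳ n u :=
    fun n u => Marley.proj_same ℳ (Marley.proj_mem ℳ n u)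
  have horth : ∀ a b u, a ≠ b → Marley.proj ℳ a (Marley.proj ℳ b u) = 0 :=
    fun a b u hab => Marley.proj_ne ℳ (Marley.proj_mem ℳ b u) hab.symm
  have hsupp : Module.supportDim R M ≤ rs.length := by
    rw [Module.supportDim_eq_ringKrullDim_quotient_annihilator, hdim, hlen]
  -- the Hilbert polynomial has degree less than `d`
  have hdegP : P.degree < d := by
    obtain ⟨j, C, hC⟩ := Marley.sum_bound (𝒜 1 : Set R) hstd (Marley.proj ℳ) hdeg1
      (Marley.proj_bdd ℳ) hidem horth rs hrad hwr hsupp hM hlength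
    rw [hlen] at hC
    exact Marley.degree_lt_of_sum_bound P hM N hN d j C hC
  -- the `d`-th difference of the Hilbert function is nonnegative
  have hpos : ∀ n, 0 ≤ deltaOp^[d] (fun n => (hM n : ℚ)) n := by
    obtain ⟨s, hs, hspan⟩ := (Submodule.fg_span_iff_fg_span_finset_subset (R := R)
      (𝒜 1 : Set R)).mp (Ideal.fg_of_isNoetherianRing _)
    let x : Fin s.card → R := fun i => (s.equivFin.symm i : R)
    have hxr : Set.range x = (s : Set R) := by
      ext r
      constructor
      · rintro ⟨i, rfl⟩
        exact (s.equivFin.symm i).2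
      · intro hr
        exact ⟨s.equivFin ⟨r, hr⟩, by simp [x]⟩
    have hx : ∀ n i u, Marley.proj ℳ (n + 1) (x i • u) = x i • Marley.proj ℳ n u :=
      fun n i u => hdeg1 (x i) (hs (by rw [← hxr]; exact ⟨i, rfl⟩)) n u
    intro n
    have := Marley.delta_nonneg_local x rs (by
      intro r hr
      have h1 := hrad r hr
      have h2 : Ideal.span (𝒜 1 : Set R) = Ideal.span (Set.range x) := by
        rw [hxr]; exact hspan
      rwa [h2] at h1) hwr (Marley.proj ℳ) hidem hx hM hlength n
    rwa [hlen] at this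
  refine Marley.sign_alt _ N ?_ d ?_ (d - i) i (by omega) n
  · intro n hn
    simp only [hN n hn, sub_self]
  · intro n
    rw [Marley.delta_sub]
    simp only [Marley.delta_poly P d hdegP n, sub_zero]
    exact hpos n
end

section
/- Let R be a standard graded ring over an Artinian local ring and M a finitely generated graded Cohen-Macaulay R-module of positive dimension. If the Hilbert function of M equals its Hilbert polynomial at some integer k, then they agree at all integers n ≥ k. -/
open Pointwise

namespace HilbCM

section depth
variable {R M : Type*} [CommRing R] [AddCommGroup M] [Module R M]

/-- `x` is a nonzerodivisor on `M / N`. -/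
def Reg (x : R) (N : Submodule R M) : Prop := ∀ m : M, x • m ∈ N → m ∈ N

/-- The submodule `N + x M`. -/
def adj (N : Submodule R M) (x : R) : Submodule R M := N ⊔ x • ⊤

lemma mem_adj {N : Submodule R M} {x : R} {m : M} :
    m ∈ adj N x ↔ ∃ n ∈ N, ∃ m' : M, m = n + x • m' := by
  simp only [adj, Submodule.mem_sup, Submodule.mem_smul_pointwise_iff_exists, Submodule.mem_top,
    true_and]
  constructor
  · rintro ⟨n, hn, _, ⟨m', rfl⟩, rfl⟩
    exact ⟨n, hn, m', rfl⟩
  · rintro ⟨n, hn, m', rfl⟩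
    exact ⟨n, hn, _, ⟨m', rfl⟩, rfl⟩

lemma adj_comm (N : Submodule R M) (x y : R) : adj (adj N x) y = adj (adj N y) x := by
  simp only [adj]
  rw [sup_assoc, sup_assoc, sup_comm (x • ⊤)]

/-- Existence of a weakly regular sequence of length `n` in `I` on `M / N`. -/
def Dep (I : Ideal R) : ℕ → Submodule R M → Prop
  | 0, _ => True
  | n + 1, N => ∃ y ∈ I, Reg y N ∧ Dep I n (adj N y)

/-- No nonzero element of `M / N` is killed by `I`. -/
def PosDep (I : Ideal R) (N : Submodule R M) : Prop :=
  ∀ m : M, (∀ i ∈ I, i • m ∈ N) → m ∈ N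

lemma Dep.pos {I : Ideal R} {n : ℕ} {N : Submodule R M} (h : Dep I (n + 1) N) : PosDep I N := by
  obtain ⟨y, hy, hr, -⟩ := h
  exact fun m hm => hr m (hm y hy)

lemma Reg.pow {x : R} {N : Submodule R M} (h : Reg x N) (n : ℕ) : Reg (x ^ n) N := by
  induction n with
  | zero => intro m hm; simpa using hm
  | succ n ih => intro m hm; rw [pow_succ, mul_smul] at hm; exact h _ (ih _ hm)

lemma Reg.swap {x z : R} {N : Submodule R M} (hx : Reg x N) (hz : Reg z (adj N x)) :
    Reg x (adj N z) := by
  intro m hm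
  obtain ⟨n, hn, m', e⟩ := mem_adj.1 hm
  have h1 : m' ∈ adj N x := by
    apply hz
    refine mem_adj.2 ⟨-n, N.neg_mem hn, m, ?_⟩
    rw [e]; abel
  obtain ⟨n', hn', m'', rfl⟩ := mem_adj.1 h1
  have h2 : m - z • m'' ∈ N := by
    apply hx
    have : x • (m - z • m'') = n + z • n' := by
      rw [smul_sub, e, smul_add, smul_comm x z]; abel
    rw [this]
    exact N.add_mem hn (N.smul_mem _ hn')
  exact mem_adj.2 ⟨_, h2, m'', by abel⟩

lemma PosDep.swap {I : Ideal R} {x y : R} {N : Submodule R M} (hx : Reg x N) (hy : Reg y N)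
    (hxI : x ∈ I) (h : PosDep I (adj N x)) : PosDep I (adj N y) := by
  intro m hm
  obtain ⟨n, hn, m', e⟩ := mem_adj.1 (hm x hxI)
  have h1 : m' ∈ adj N x := by
    apply h
    intro i hi
    obtain ⟨ni, hni, mi, ei⟩ := mem_adj.1 (hm i hi)
    have h2 : i • m' - x • mi ∈ N := by
      apply hy
      have : y • (i • m' - x • mi) = x • ni - i • n := by
        have e1 : i • (x • m) = i • n + y • i • m' := by rw [e, smul_add, smul_comm i y]
        have e2 : i • (x • m) = x • ni + y • x • mi := by
          rw [smul_comm, ei, smul_add, smul_comm x y]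
        rw [smul_sub, sub_eq_sub_iff_add_eq_add, add_comm, ← e1, e2]
      rw [this]
      exact N.sub_mem (N.smul_mem _ hni) (N.smul_mem _ hn)
    exact mem_adj.2 ⟨_, h2, mi, by abel⟩
  obtain ⟨n', hn', m'', rfl⟩ := mem_adj.1 h1
  have h2 : m - y • m'' ∈ N := by
    apply hx
    have : x • (m - y • m'') = n + y • n' := by
      rw [smul_sub, e, smul_add, smul_comm x y]; abel
    rw [this]
    exact N.add_mem hn (N.smul_mem _ hn')
  exact mem_adj.2 ⟨_, h2, m'', by abel⟩

/-- The exchange lemma for regular sequences. -/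
lemma Dep.exchange {I : Ideal R}
    (H : ∀ N₁ N₂ N₃ : Submodule R M, PosDep I N₁ → PosDep I N₂ → PosDep I N₃ →
      ∃ z ∈ I, Reg z N₁ ∧ Reg z N₂ ∧ Reg z N₃) :
    ∀ (n : ℕ) (N : Submodule R M) (x : R), x ∈ I → Reg x N → Dep I (n + 1) N → Dep I n (adj N x)
  | 0, _, _, _, _, _ => trivial
  | n + 1, N, x, hxI, hx, ⟨y, hyI, hy, hd⟩ => by
    have hpx : PosDep I (adj N x) := PosDep.swap hy hx hyI hd.pos
    obtain ⟨z, hzI, hz1, hz2, hz3⟩ := H N (adj N x) (adj N y) (fun m hm => hx m (hm x hxI)) hpx hd.pos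
    have d1 : Dep I n (adj (adj N y) z) := Dep.exchange H n _ z hzI hz3 hd
    have d2 : Dep I (n + 1) (adj N z) := ⟨y, hyI, hy.swap hz3, by rwa [adj_comm]⟩
    have d3 := Dep.exchange H n _ x hxI (hx.swap hz2) d2
    exact ⟨z, hzI, hz2, by rwa [adj_comm]⟩

lemma reg_iff {x : R} {N : Submodule R M} : Reg x N ↔ IsSMulRegular (M ⧸ N) x := by
  rw [isSMulRegular_iff_right_eq_zero_of_smul]
  constructor
  · intro h m
    obtain ⟨m, rfl⟩ := Submodule.Quotient.mk_surjective _ m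
    rw [← Submodule.Quotient.mk_smul, Submodule.Quotient.mk_eq_zero, Submodule.Quotient.mk_eq_zero]
    exact h m
  · intro h m
    have := h (Submodule.Quotient.mk m)
    rwa [← Submodule.Quotient.mk_smul, Submodule.Quotient.mk_eq_zero,
      Submodule.Quotient.mk_eq_zero] at this

lemma dep_of_weaklyRegular {I : Ideal R} (rs : List R) (hI : ∀ r ∈ rs, r ∈ I)
    (h : RingTheory.Sequence.IsWeaklyRegular M rs) : Dep I rs.length (⊥ : Submodule R M) := by
  have key : ∀ j i : ℕ, i + j = rs.length →
      Dep I j (Ideal.ofList (rs.take i) • ⊤ : Submodule R M) := by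
    intro j
    induction j with
    | zero => intro i _; trivial
    | succ j ih =>
      intro i hi
      have hlt : i < rs.length := by omega
      refine ⟨rs[i], hI _ (List.getElem_mem _), ?_, ?_⟩
      · exact reg_iff.2 (h.regular_mod_prev i hlt)
      · have := ih (i + 1) (by omega)
        rw [List.take_succ_eq_append_getElem hlt, Ideal.ofList_append, Ideal.ofList_singleton,
          Submodule.sup_smul, Submodule.ideal_span_singleton_smul] at this
        exact this
  simpa using key rs.length 0 (by simp)

lemma supportDim_adj [Module.Finite R M] {x : R} {N : Submodule R M} (h : Reg x N) :
    Module.supportDim R (M ⧸ adj N x) + 1 ≤ Module.supportDim R (M ⧸ N) := by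
  have h1 := Module.supportDim_quotSMulTop_succ_le_of_notMem_minimalPrimes (M := M ⧸ N) (x := x)
    (fun p hp => (reg_iff.1 h).notMem_of_mem_minimalPrimes hp)
  refine le_trans ?_ h1
  gcongr
  have hle : N ≤ LinearMap.ker ((Submodule.mkQ (x • (⊤ : Submodule R (M ⧸ N)))).comp N.mkQ) := by
    intro m hm
    simp [(Submodule.Quotient.mk_eq_zero N).2 hm]
  have hle2 : x • (⊤ : Submodule R (M ⧸ N)) ≤
      LinearMap.ker (Submodule.factor (show N ≤ adj N x from le_sup_left)) := by
    intro m hm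
    obtain ⟨m', -, rfl⟩ := (Submodule.mem_smul_pointwise_iff_exists _ _ _).1 hm
    obtain ⟨m', rfl⟩ := Submodule.Quotient.mk_surjective _ m'
    rw [LinearMap.mem_ker, ← Submodule.Quotient.mk_smul]
    exact (Submodule.Quotient.mk_eq_zero _).2 (mem_adj.2 ⟨0, N.zero_mem, m', by simp⟩)
  refine Module.supportDim_le_of_surjective (Submodule.liftQ _ _ hle2) ?_
  intro m
  obtain ⟨m, rfl⟩ := Submodule.Quotient.mk_surjective _ m
  exact ⟨Submodule.Quotient.mk (Submodule.Quotient.mk m), rfl⟩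

end depth

section avoid
variable {A R : Type*} [CommRing A] [CommRing R] [Algebra A R]
  (𝒜 : ℕ → Submodule A R) [GradedAlgebra 𝒜]

lemma exists_comp_notMem {P : Ideal R} {r : R} (h : r ∉ P) :
    ∃ i, (DirectSum.decompose 𝒜 r i : R) ∉ P := by
  by_contra! hc
  apply h
  classical
  rw [← DirectSum.sum_support_decompose 𝒜 r]
  exact P.sum_mem fun i _ => hc i

lemma exists_mem_inter {P : Ideal R} (hP : P.IsPrime) (T : Finset (Ideal R))
    (hT : ∀ Q ∈ T, Q.IsHomogeneous 𝒜 ∧ ¬ Q ≤ P) :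
    ∃ b, ∃ w ∈ 𝒜 b, w ∉ P ∧ ∀ Q ∈ T, w ∈ Q := by
  classical
  induction T using Finset.induction_on with
  | empty => exact ⟨0, 1, SetLike.GradedOne.one_mem, fun h => hP.ne_top ((Ideal.eq_top_iff_one _).2 h), by simp⟩
  | insert Q T _ ih =>
    obtain ⟨b, w, hw, hwP, hwT⟩ := ih fun Q' h => hT Q' (Finset.mem_insert_of_mem h)
    obtain ⟨hQ, hQP⟩ := hT Q (Finset.mem_insert_self _ _)
    obtain ⟨r, hr, hrP⟩ := SetLike.not_le_iff_exists.1 hQP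
    obtain ⟨i, hi⟩ := exists_comp_notMem 𝒜 hrP
    refine ⟨i + b, _, SetLike.GradedMul.mul_mem (DirectSum.decompose 𝒜 r i).2 hw, ?_, ?_⟩
    · intro hm
      exact (hP.mem_or_mem hm).elim hi hwP
    · intro Q' hQ'
      rcases Finset.mem_insert.1 hQ' with rfl | h
      · exact Ideal.mul_mem_right _ _ (hQ i hr)
      · exact Ideal.mul_mem_left _ _ (hwT _ h)

/-- Homogeneous prime avoidance. -/
lemma hom_avoid (S : Finset (Ideal R))
    (hS : ∀ P ∈ S, P.IsPrime ∧ P.IsHomogeneous 𝒜 ∧ ∃ a > 0, ∃ z ∈ 𝒜 a, z ∉ P):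
    ∃ a > 0, ∃ z ∈ 𝒜 a, ∀ P ∈ S, z ∉ P := by
  classical
  induction S using Finset.strongInduction with
  | H S ih =>
    rcases S.eq_empty_or_nonempty with rfl | hne
    · exact ⟨1, one_pos, 0, Submodule.zero_mem _, by simp⟩
    obtain ⟨P, hPm⟩ := S.exists_minimal hne
    obtain ⟨hP, hPh, a0, ha0, f, hf, hfP⟩ := hS P hPm.1
    obtain ⟨a, ha, z, hz, hzS⟩ := ih (S.erase P) (Finset.erase_ssubset hPm.1)
      (fun Q hQ => hS Q (Finset.mem_of_mem_erase hQ))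
    by_cases hzP : z ∈ P
    swap
    · refine ⟨a, ha, z, hz, fun Q hQ => ?_⟩
      by_cases h : Q = P
      · exact h ▸ hzP
      · exact hzS Q (Finset.mem_erase.2 ⟨h, hQ⟩)
    obtain ⟨b, w, hw, hwP, hwT⟩ := exists_mem_inter 𝒜 hP (S.erase P) (fun Q hQ => by
      obtain ⟨hne, hQS⟩ := Finset.mem_erase.1 hQ
      exact ⟨(hS Q hQS).2.1, fun hle => hne (le_antisymm hle (hPm.2 hQS hle))⟩)
    have hfw : f * w ∈ 𝒜 (a0 + b) := SetLike.GradedMul.mul_mem hf hw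
    have hfwP : f * w ∉ P := fun h => (hP.mem_or_mem h).elim hfP hwP
    refine ⟨(a0 + b) * a, by positivity, z ^ (a0 + b) + (f * w) ^ a, ?_, ?_⟩
    · refine Submodule.add_mem _ (by simpa using SetLike.pow_mem_graded (a0 + b) hz) ?_
      have := SetLike.pow_mem_graded a hfw
      rwa [smul_eq_mul, mul_comm] at this
    · intro Q hQ hm
      by_cases h : Q = P
      · subst h
        have := (Submodule.add_mem_iff_right _ (Ideal.pow_mem_of_mem _ hzP (a0 + b) (by omega))).1 hm
        exact hfwP (hP.mem_of_pow_mem _ this)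
      · have hQ' := Finset.mem_erase.2 ⟨h, hQ⟩
        have := (Submodule.add_mem_iff_left _ (Ideal.pow_mem_of_mem _
          (Ideal.mul_mem_left _ f (hwT Q hQ')) a ha)).1 hm
        exact hzS Q hQ' ((hS Q hQ).1.mem_of_pow_mem _ this)

/-- The ideal `𝔪_A R + R_+`. -/
def mm [IsLocalRing A] : Ideal R := Ideal.span
        ((algebraMap A R) '' (IsLocalRing.maximalIdeal A : Set A) ∪
          ⋃ i ∈ Set.Ioi (0 : ℕ), (𝒜 i : Set R))

lemma mem_mm [IsLocalRing A] {a : ℕ} (ha : 0 < a) {z : R} (hz : z ∈ 𝒜 a) : z ∈ mm 𝒜 :=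
  Ideal.subset_span (Or.inr (Set.mem_biUnion (Set.mem_Ioi.2 ha) hz))

variable {M : Type*} [AddCommGroup M] [Module R M]

lemma exists_notMem_of_assoc [IsArtinianRing A] [IsLocalRing A] [IsNoetherianRing R]
    {N : Submodule R M} (hN : PosDep (mm 𝒜) N) {P : Ideal R} (hP : P ∈ associatedPrimes R (M ⧸ N)) :
    ∃ a > 0, ∃ z ∈ 𝒜 a, z ∉ P := by
  by_contra! hc
  obtain ⟨hp, m, hm⟩ := isAssociatedPrime_iff.1 hP
  obtain ⟨m, rfl⟩ := Submodule.Quotient.mk_surjective _ m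
  have hmem : ∀ r : R, r ∈ P ↔ r • m ∈ N := by
    intro r
    rw [hm, Submodule.mem_colon_singleton, Submodule.mem_bot, ← Submodule.Quotient.mk_smul,
      Submodule.Quotient.mk_eq_zero]
  have hle : mm 𝒜 ≤ P := by
    refine Ideal.span_le.2 ?_
    rintro r (⟨a, ha, rfl⟩ | hr)
    · obtain ⟨n, hn⟩ := (IsArtinianRing.isNilpotent_jacobson_bot (R := A))
      rw [IsLocalRing.jacobson_eq_maximalIdeal _ bot_ne_top] at hn
      have h0 : a ^ n = 0 := by
        have := Ideal.pow_mem_pow ha n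
        rwa [hn] at this
      refine hp.mem_of_pow_mem n ?_
      rw [← map_pow, h0, map_zero]
      exact P.zero_mem
    · simp only [Set.mem_iUnion] at hr
      obtain ⟨i, hi, hr⟩ := hr
      exact hc i hi r hr
  have hmN := hN m fun i hi => (hmem i).1 (hle hi)
  exact hp.ne_top ((Ideal.eq_top_iff_one _).2 ((hmem 1).2 (by simpa using hmN)))

lemma exists_hom_reg [IsArtinianRing A] [IsLocalRing A] [IsNoetherianRing R] [Module.Finite R M]
    (S : Finset (Submodule R M)) (hS : ∀ N ∈ S, PosDep (mm 𝒜) N) :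
    ∃ a > 0, ∃ z ∈ 𝒜 a, ∀ N ∈ S, Reg z N := by
  classical
  let T : Finset (Ideal R) := S.biUnion fun N => (associatedPrimes.finite R (M ⧸ N)).toFinset
  have hT : ∀ P, P ∈ T ↔ ∃ N ∈ S, P ∈ associatedPrimes R (M ⧸ N) := by
    intro P; simp [T]
  obtain ⟨a, ha, z, hz, h⟩ := hom_avoid 𝒜 (T.image fun P => (P.homogeneousCore 𝒜).toIdeal) (by
    intro Q hQ
    obtain ⟨P, hP, rfl⟩ := Finset.mem_image.1 hQ
    obtain ⟨N, hN, hPN⟩ := (hT P).1 hP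
    refine ⟨hPN.isPrime.homogeneousCore, (P.homogeneousCore 𝒜).isHomogeneous, ?_⟩
    obtain ⟨a, ha, z, hz, hzP⟩ := exists_notMem_of_assoc 𝒜 (hS N hN) hPN
    exact ⟨a, ha, z, hz, fun h => hzP (P.toIdeal_homogeneousCore_le 𝒜 h)⟩)
  refine ⟨a, ha, z, hz, fun N hN m hm => ?_⟩
  by_contra hmN
  obtain ⟨P, hP, hle⟩ := exists_le_isAssociatedPrime_of_isNoetherianRing R
    (Submodule.Quotient.mk m : M ⧸ N) (by rwa [Ne, Submodule.Quotient.mk_eq_zero])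
  have hzP : z ∈ P := hle (by
    rw [Submodule.mem_colon_singleton, Submodule.mem_bot, ← Submodule.Quotient.mk_smul,
      Submodule.Quotient.mk_eq_zero]
    exact hm)
  refine h _ (Finset.mem_image_of_mem _ ((hT P).2 ⟨N, hN, hP⟩)) ?_
  exact Ideal.mem_homogeneousCore_of_homogeneous_of_mem ⟨a, hz⟩ hzP

end avoid

section graded
variable {A R M : Type*} [CommRing A] [CommRing R] [Algebra A R]
  (𝒜 : ℕ → Submodule A R)
  [AddCommGroup M] [Module A M] [Module R M] [IsScalarTower A R M]
  (ℳ : ℤ → Submodule A M) [DirectSum.Decomposition ℳ]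

/-- The degree `i` component. -/
def comp (i : ℤ) (m : M) : M := DirectSum.decompose ℳ m i

lemma comp_mem (i : ℤ) (m : M) : comp ℳ i m ∈ ℳ i := (DirectSum.decompose ℳ m i).2

lemma comp_add (i : ℤ) (m m' : M) : comp ℳ i (m + m') = comp ℳ i m + comp ℳ i m' := by
  simp [comp, DirectSum.decompose_add]

lemma comp_zero (i : ℤ) : comp ℳ i 0 = 0 := by simp [comp]

lemma comp_of_mem {i : ℤ} {m : M} (h : m ∈ ℳ i) : comp ℳ i m = m :=
  DirectSum.decompose_of_mem_same ℳ h

lemma comp_of_mem_ne {i j : ℤ} {m : M} (h : m ∈ ℳ i) (hij : i ≠ j) : comp ℳ j m = 0 :=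
  DirectSum.decompose_of_mem_ne ℳ h hij

lemma comp_smul (hcompat : ∀ (i : ℕ) (n : ℤ), ∀ r ∈ 𝒜 i, ∀ m ∈ ℳ n, r • m ∈ ℳ (n + i))
    {a : ℕ} {r : R} (hr : r ∈ 𝒜 a) (i : ℤ) (m : M) :
    comp ℳ (i + a) (r • m) = r • comp ℳ i m := by
  induction m using DirectSum.Decomposition.inductionOn ℳ with
  | zero => simp [comp_zero]
  | @homogeneous j m =>
    have hm := hcompat a j r hr m m.2
    by_cases h : j = i
    · subst h
      rw [comp_of_mem ℳ hm, comp_of_mem ℳ m.2]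
    · rw [comp_of_mem_ne ℳ hm (by omega), comp_of_mem_ne ℳ m.2 h, smul_zero]
  | add m m' h h' => rw [smul_add, comp_add, h, h', comp_add, smul_add]

/-- Homogeneous submodules. -/
def Hom (N : Submodule R M) : Prop := ∀ m ∈ N, ∀ i, comp ℳ i m ∈ N

lemma Hom.adj (hcompat : ∀ (i : ℕ) (n : ℤ), ∀ r ∈ 𝒜 i, ∀ m ∈ ℳ n, r • m ∈ ℳ (n + i))
    {N : Submodule R M} (hN : Hom ℳ N) {a : ℕ} {r : R} (hr : r ∈ 𝒜 a) : Hom ℳ (adj N r) := by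
  intro m hm i
  obtain ⟨n, hn, m', rfl⟩ := mem_adj.1 hm
  have := comp_smul 𝒜 ℳ hcompat hr (i - a) m'
  rw [sub_add_cancel] at this
  exact mem_adj.2 ⟨_, hN n hn i, comp ℳ (i - a) m', by rw [comp_add, this]⟩

/-- The degree `n` part of `N`. -/
def V (N : Submodule R M) (n : ℤ) : Submodule A (ℳ n) :=
  (N.restrictScalars A).comap (ℳ n).subtype

lemma mem_V {N : Submodule R M} {n : ℤ} {m : ℳ n} : m ∈ V ℳ N n ↔ (m : M) ∈ N := Iff.rfl

/-- The Hilbert function of `M / N`. -/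
noncomputable def L (N : Submodule R M) (n : ℤ) : ℕ := (Module.length A (ℳ n ⧸ V ℳ N n)).toNat

lemma length_adj (hcompat : ∀ (i : ℕ) (n : ℤ), ∀ r ∈ 𝒜 i, ∀ m ∈ ℳ n, r • m ∈ ℳ (n + i))
    {N : Submodule R M} (hN : Hom ℳ N) {a : ℕ} {x : R} (hx : x ∈ 𝒜 a) (hreg : Reg x N) (n : ℤ) :
    Module.length A (ℳ (n + a) ⧸ V ℳ N (n + a)) = Module.length A (ℳ n ⧸ V ℳ N n) +
      Module.length A (ℳ (n + a) ⧸ V ℳ (adj N x) (n + a)) := by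
  let f0 : ℳ n →ₗ[A] ℳ (n + a) :=
    { toFun := fun m => ⟨x • (m : M), hcompat a n x hx m m.2⟩
      map_add' := fun m m' => by ext; simp
      map_smul' := fun c m => by
        ext
        change x • (c • (m : M)) = c • (x • (m : M))
        rw [← algebraMap_smul R c, smul_comm, algebraMap_smul] }
  have hle : V ℳ N (n + a) ≤ V ℳ (adj N x) (n + a) := fun m hm =>
    (le_sup_left : N ≤ adj N x) hm
  have hf0 : V ℳ N n ≤ (V ℳ N (n + a)).comap f0 := fun m hm => N.smul_mem x hm
  refine Module.length_eq_add_of_exact (Submodule.mapQ _ _ f0 hf0) (Submodule.factor hle) ?_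
    (Submodule.factor_surjective hle) ?_
  · rw [injective_iff_map_eq_zero]
    intro m h
    obtain ⟨m, rfl⟩ := Submodule.Quotient.mk_surjective _ m
    rw [Submodule.mapQ_apply, Submodule.Quotient.mk_eq_zero] at h
    exact (Submodule.Quotient.mk_eq_zero _).2 (hreg m h)
  · intro m
    obtain ⟨m, rfl⟩ := Submodule.Quotient.mk_surjective _ m
    constructor
    · intro h
      have h1 : (m : M) ∈ adj N x := (Submodule.Quotient.mk_eq_zero (V ℳ (adj N x) (n + a))).1 h
      obtain ⟨u, hu, m', e⟩ := mem_adj.1 h1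
      have e2 : (m : M) = comp ℳ (n + a) u + x • comp ℳ n m' := by
        rw [← comp_smul 𝒜 ℳ hcompat hx, ← comp_add, ← e, comp_of_mem ℳ m.2]
      refine ⟨Submodule.Quotient.mk ⟨comp ℳ n m', comp_mem ℳ _ _⟩, ?_⟩
      rw [Submodule.mapQ_apply, eq_comm, Submodule.Quotient.eq, mem_V]
      have : ((m - f0 ⟨comp ℳ n m', comp_mem ℳ _ _⟩ : ℳ (n + a)) : M) = comp ℳ (n + a) u := by
        change (m : M) - x • comp ℳ n m' = _
        rw [e2]; abel
      rw [this]
      exact hN u hu _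
    · rintro ⟨m', h⟩
      obtain ⟨m', rfl⟩ := Submodule.Quotient.mk_surjective _ m'
      rw [← h, Submodule.mapQ_apply]
      refine (Submodule.Quotient.mk_eq_zero (V ℳ (adj N x) (n + a))).2 ?_
      exact mem_adj.2 ⟨0, N.zero_mem, m', by simp [f0]⟩

lemma length_ne_top (hfin : ∀ n, Module.length A (ℳ n) ≠ ⊤) (N : Submodule R M) (n : ℤ) :
    Module.length A (ℳ n ⧸ V ℳ N n) ≠ ⊤ :=
  ne_top_of_le_ne_top (hfin n) (Module.length_le_of_surjective (V ℳ N n).mkQ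
    (Submodule.mkQ_surjective _))

lemma L_adj (hcompat : ∀ (i : ℕ) (n : ℤ), ∀ r ∈ 𝒜 i, ∀ m ∈ ℳ n, r • m ∈ ℳ (n + i))
    (hfin : ∀ n, Module.length A (ℳ n) ≠ ⊤)
    {N : Submodule R M} (hN : Hom ℳ N) {a : ℕ} {x : R} (hx : x ∈ 𝒜 a) (hreg : Reg x N) (n : ℤ) :
    L ℳ N (n + a) = L ℳ N n + L ℳ (adj N x) (n + a) := by
  rw [L, length_adj 𝒜 ℳ hcompat hN hx hreg, ENat.toNat_add]
  · rfl
  · exact length_ne_top ℳ hfin _ _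
  · exact length_ne_top ℳ hfin _ _

lemma L_eq_zero_iff (hfin : ∀ n, Module.length A (ℳ n) ≠ ⊤) (N : Submodule R M) (n : ℤ) :
    L ℳ N n = 0 ↔ ∀ m ∈ ℳ n, m ∈ N := by
  rw [L, ENat.toNat_eq_zero, or_iff_left (length_ne_top ℳ hfin _ _), Module.length_eq_zero_iff,
    Submodule.Quotient.subsingleton_iff, Submodule.eq_top_iff']
  simp [mem_V]

/-- A degree beyond which everything is generated from lower degrees. -/
lemma exists_bound [Module.Finite R M]
    (hcompat : ∀ (i : ℕ) (n : ℤ), ∀ r ∈ 𝒜 i, ∀ m ∈ ℳ n, r • m ∈ ℳ (n + i))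
    (hstd : Algebra.adjoin A (𝒜 1 : Set R) = ⊤) :
    ∃ D : ℤ, ∀ N : Submodule R M, ∀ n ≥ D, (∀ m ∈ ℳ n, m ∈ N) →
      ∀ i ≥ n, ∀ m ∈ ℳ i, m ∈ N := by
  classical
  obtain ⟨S, hS⟩ := (Module.Finite.fg_top : (⊤ : Submodule R M).FG)
  obtain ⟨D, hD⟩ := (S.biUnion fun m => (DirectSum.decompose ℳ m).support).exists_le
  refine ⟨D, fun N n hn h => ?_⟩
  have hcA : ∀ (c : A) (i : ℤ) (m : M), comp ℳ i (c • m) = c • comp ℳ i m := by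
    intro c i m
    simp only [comp, DirectSum.decompose_smul]
    rfl
  have hsm : ∀ r : R, ∀ m : M, (∀ i > n, comp ℳ i m ∈ N) → ∀ i > n, comp ℳ i (r • m) ∈ N := by
    intro r
    have hr : r ∈ Algebra.adjoin A (𝒜 1 : Set R) := hstd ▸ Algebra.mem_top
    induction hr using Algebra.adjoin_induction with
    | mem x hx =>
      intro m hm i hi
      have := comp_smul 𝒜 ℳ hcompat hx (i - 1) m
      rw [Nat.cast_one, sub_add_cancel] at this
      rw [this]
      refine N.smul_mem _ ?_
      rcases eq_or_ne (i - 1) n with e | e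
      · exact h _ (e ▸ comp_mem ℳ _ _)
      · exact hm _ (by omega)
    | algebraMap c =>
      intro m hm i hi
      rw [algebraMap_smul, hcA]
      exact (N.restrictScalars A).smul_mem _ (hm i hi)
    | add x y _ _ hx hy =>
      intro m hm i hi
      rw [add_smul, comp_add]
      exact N.add_mem (hx m hm i hi) (hy m hm i hi)
    | mul x y _ _ hx hy =>
      intro m hm i hi
      rw [mul_smul]
      exact hx _ (hy m hm) i hi
  let T : Submodule R M :=
    { carrier := {m | ∀ i > n, comp ℳ i m ∈ N}
      add_mem' := fun {m m'} hm hm' i hi => by rw [comp_add]; exact N.add_mem (hm i hi) (hm' i hi)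
      zero_mem' := fun i _ => by rw [comp_zero]; exact N.zero_mem
      smul_mem' := fun r m hm => hsm r m hm }
  have hT : T = ⊤ := by
    rw [eq_top_iff, ← hS, Submodule.span_le]
    intro m hm i hi
    have : comp ℳ i m = 0 := by
      by_contra hne
      have := hD i (Finset.mem_biUnion.2 ⟨m, hm, by
        rw [DFinsupp.mem_support_iff]
        intro h0
        exact hne (by rw [comp, h0]; rfl)⟩)
      omega
    rw [this]
    exact N.zero_mem
  intro i hi m hm
  rcases eq_or_lt_of_le hi with rfl | hlt
  · exact h m hm
  · have : m ∈ T := hT ▸ Submodule.mem_top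
    have := this i hlt
    rwa [comp_of_mem ℳ hm] at this

lemma eventually_zero [IsNoetherianRing R] [Module.Finite R M]
    (hcompat : ∀ (i : ℕ) (n : ℤ), ∀ r ∈ 𝒜 i, ∀ m ∈ ℳ n, r • m ∈ ℳ (n + i))
    [GradedAlgebra 𝒜]
    {N : Submodule R M} (hN : Hom ℳ N) (hdim : Module.supportDim R (M ⧸ N) ≤ 0) :
    ∃ n0 : ℤ, ∀ n ≥ n0, ∀ m ∈ ℳ n, m ∈ N := by
  have hart : IsArtinian R (M ⧸ N) := by
    rw [Module.supportDim_eq_ringKrullDim_quotient_annihilator] at hdim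
    have : Ring.KrullDimLE 0 (R ⧸ Module.annihilator R (M ⧸ N)) := by
      rw [Ring.krullDimLE_iff]; exact_mod_cast hdim
    have : IsArtinianRing (R ⧸ Module.annihilator R (M ⧸ N)) :=
      IsNoetherianRing.isArtinianRing_of_krullDimLE_zero
    letI : Module (R ⧸ Module.annihilator R (M ⧸ N)) (M ⧸ N) :=
      Module.quotientAnnihilator
    have : IsScalarTower R (R ⧸ Module.annihilator R (M ⧸ N)) (M ⧸ N) :=
      (Module.isTorsionBySet_annihilator R (M ⧸ N)).isScalarTower
    have : Module.Finite (R ⧸ Module.annihilator R (M ⧸ N)) (M ⧸ N) :=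
      Module.Finite.of_restrictScalars_finite R _ _
    exact isArtinian_of_surjective_algebraMap
      (R := R ⧸ Module.annihilator R (M ⧸ N)) Ideal.Quotient.mk_surjective
  let F : ℕ → Submodule R M := fun j =>
    { carrier := {m | ∀ i < (j : ℤ), comp ℳ i m ∈ N}
      add_mem' := fun {m m'} hm hm' i hi => by rw [comp_add]; exact N.add_mem (hm i hi) (hm' i hi)
      zero_mem' := fun i _ => by rw [comp_zero]; exact N.zero_mem
      smul_mem' := fun r m hm => by
        classical
        intro i hi
        rw [← DirectSum.sum_support_decompose 𝒜 r, Finset.sum_smul]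
        induction (DirectSum.decompose 𝒜 r).support using Finset.induction_on with
        | empty => simp [comp_zero]
        | insert a s ha ih =>
          rw [Finset.sum_insert ha, comp_add]
          refine N.add_mem ?_ ih
          have := comp_smul 𝒜 ℳ hcompat (DirectSum.decompose 𝒜 r a).2 (i - a) m
          rw [sub_add_cancel] at this
          rw [this]
          exact N.smul_mem _ (hm _ (by omega)) }
  have hNF : ∀ j, N ≤ F j := fun j m hm i _ => hN m hm i
  let G : ℕ →o (Submodule R (M ⧸ N))ᵒᵈ :=
    { toFun := fun j => OrderDual.toDual ((F j).map N.mkQ)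
      monotone' := fun j j' h => by
        refine Submodule.map_mono ?_
        intro m hm i hi
        exact hm i (by omega) }
  obtain ⟨n0, hn0⟩ := IsArtinian.monotone_stabilizes G
  refine ⟨n0, fun n hn m hm => ?_⟩
  have hstab : (F n0).map N.mkQ = (F (n.toNat + 1)).map N.mkQ := hn0 _ (by omega)
  have hm1 : m ∈ F n0 := fun i hi => by
    rw [comp_of_mem_ne ℳ hm (by omega)]; exact N.zero_mem
  have h2 : N.mkQ m ∈ (F (n.toNat + 1)).map N.mkQ := hstab ▸ Submodule.mem_map_of_mem hm1
  obtain ⟨m', hm', e⟩ := h2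
  have h3 : m' - m ∈ N := (Submodule.Quotient.eq N).1 e
  have h4 : m ∈ F (n.toNat + 1) := by
    have := (F (n.toNat + 1)).sub_mem hm' (hNF _ h3)
    rwa [sub_sub_cancel] at this
  have := h4 n (by omega)
  rwa [comp_of_mem ℳ hm] at this

lemma poly_zero {P : Polynomial ℚ} {N0 : ℤ} (h : ∀ n ≥ N0, P.eval (n : ℚ) = 0) : P = 0 := by
  refine Polynomial.eq_zero_of_infinite_isRoot P ?_
  refine Set.Infinite.mono (s := (fun n : ℤ => (n : ℚ)) '' Set.Ici N0) ?_ ?_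
  · rintro _ ⟨n, hn, rfl⟩
    exact h n hn
  · exact (Set.Ici_infinite N0).image (Int.cast_injective.injOn)

lemma main_induction [IsArtinianRing A] [IsLocalRing A] [IsNoetherianRing R] [Module.Finite R M]
    [GradedAlgebra 𝒜]
    (hcompat : ∀ (i : ℕ) (n : ℤ), ∀ r ∈ 𝒜 i, ∀ m ∈ ℳ n, r • m ∈ ℳ (n + i))
    (hfin : ∀ n, Module.length A (ℳ n) ≠ ⊤) (D : ℤ)
    (hD : ∀ N : Submodule R M, ∀ n ≥ D, (∀ m ∈ ℳ n, m ∈ N) → ∀ i ≥ n, ∀ m ∈ ℳ i, m ∈ N) :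
    ∀ (d : ℕ) (N : Submodule R M), Hom ℳ N → Dep (mm 𝒜) d N →
      Module.supportDim R (M ⧸ N) ≤ d →
      ∀ (P : Polynomial ℚ) (k N0 : ℤ), (1 ≤ d ∨ D ≤ k) →
      (∀ n ≥ N0, P.eval (n : ℚ) = L ℳ N n) → P.eval (k : ℚ) = L ℳ N k →
      ∀ n ≥ k, P.eval (n : ℚ) = L ℳ N n := by
  intro d
  induction d with
  | zero =>
    intro N hN _ hdim P k N0 hDk hP hk n hn
    obtain ⟨n0, hn0⟩ := eventually_zero 𝒜 ℳ hcompat hN (by simpa using hdim)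
    have hP0 : P = 0 := poly_zero (N0 := max N0 n0) fun n hn => by
      rw [hP n (le_trans (le_max_left _ _) hn),
        (L_eq_zero_iff ℳ hfin N n).2 (hn0 n (le_trans (le_max_right _ _) hn)), Nat.cast_zero]
    subst hP0
    rw [Polynomial.eval_zero, eq_comm, Nat.cast_eq_zero, L_eq_zero_iff ℳ hfin] at hk
    rw [Polynomial.eval_zero, eq_comm, Nat.cast_eq_zero, L_eq_zero_iff ℳ hfin]
    exact hD N k (by omega) hk n hn
  | succ d ih =>
    intro N hN hdep hdim P k N0 _ hP hk n hn
    obtain ⟨a0, ha0, x, hx, hreg⟩ := exists_hom_reg 𝒜 {N} (by simpa using hdep.pos)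
    replace hreg := hreg N (Finset.mem_singleton_self _)
    set c : ℕ := (max (N0 - k) (D - k)).toNat + 1 with hc
    have hy : x ^ c ∈ 𝒜 (c * a0) := by simpa using SetLike.pow_mem_graded c hx
    have hyreg : Reg (x ^ c) N := hreg.pow c
    generalize x ^ c = y at hy hyreg
    have hac : c ≤ c * a0 := Nat.le_mul_of_pos_right c ha0
    generalize c * a0 = a at hy hac
    have h1 : N0 - k ≤ a := by omega
    have h2 : D - k ≤ a := by omega
    have ha : 0 < a := by omega
    have hL := L_adj 𝒜 ℳ hcompat hfin hN hy hyreg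
    have hdep' : Dep (mm 𝒜) d (adj N y) := by
      refine Dep.exchange ?_ d N y (mem_mm 𝒜 ha hy) hyreg hdep
      intro N₁ N₂ N₃ h₁ h₂ h₃
      classical
      obtain ⟨b, hb, z, hz, h⟩ := exists_hom_reg 𝒜 {N₁, N₂, N₃} (by simp [h₁, h₂, h₃])
      exact ⟨z, mem_mm 𝒜 hb hz, h _ (by simp), h _ (by simp), h _ (by simp)⟩
    have hdim' : Module.supportDim R (M ⧸ adj N y) ≤ d := by
      have := (supportDim_adj hyreg).trans hdim
      push_cast at this
      exact ENat.WithBot.add_le_add_one_right_iff.1 this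
    have hev : ∀ n : ℤ, (P - P.comp (Polynomial.X - Polynomial.C (a : ℚ))).eval ((n + a : ℤ) : ℚ) =
        P.eval ((n + a : ℤ) : ℚ) - P.eval (n : ℚ) := by
      intro n; simp
    have hL' : ∀ n : ℤ, ((L ℳ (adj N y) (n + a) : ℕ) : ℚ) = L ℳ N (n + a) - L ℳ N n := by
      intro n; rw [hL n]; push_cast; ring
    have := ih (adj N y) (hN.adj 𝒜 ℳ hcompat hy) hdep' hdim'
      (P - P.comp (Polynomial.X - Polynomial.C (a : ℚ))) (k + a) (N0 + a) (Or.inr (by omega))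
      (fun m hm => by
        obtain ⟨m, rfl⟩ : ∃ m', m = m' + (a : ℤ) := ⟨m - a, by ring⟩
        rw [hev, hL', hP _ (by omega), hP m (by omega)])
      (by rw [hev, hL', hk, hP _ (by omega)])
      (n + a) (by omega)
    rw [hev, hL', hP (n + a) (by omega)] at this
    linarith

end graded

end HilbCM

/-- If the Hilbert function of a positive-dimensional graded Cohen–Macaulay module
agrees with its Hilbert polynomial at some integer `k`, then they agree for all `n ≥ k`. -/
theorem hilbert_function_eq_polynomial_of_eq
    {A R M : Type*} [CommRing A] [IsArtinianRing A] [IsLocalRing A]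
    [CommRing R] [Algebra A R] [Algebra.FiniteType A R]
    (𝒜 : ℕ → Submodule A R) [GradedAlgebra 𝒜]
    (hstd : Algebra.adjoin A (𝒜 1 : Set R) = ⊤)
    [AddCommGroup M] [Module A M] [Module R M] [IsScalarTower A R M] [Module.Finite R M]
    (ℳ : ℤ → Submodule A M) [DirectSum.Decomposition ℳ]
    (hcompat : ∀ (i : ℕ) (n : ℤ), ∀ r ∈ 𝒜 i, ∀ m ∈ ℳ n, r • m ∈ ℳ (n + i))
    (d : ℕ)
    (hdim : ringKrullDim (R ⧸ Module.annihilator R M) = d)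
    (hCM : ∃ rs : List R, rs.length = d ∧
      (∀ r ∈ rs, r ∈ Ideal.span
        ((algebraMap A R) '' (IsLocalRing.maximalIdeal A : Set A) ∪
          ⋃ i ∈ Set.Ioi (0 : ℕ), (𝒜 i : Set R))) ∧
      RingTheory.Sequence.IsRegular M rs)
    (hM : ℤ → ℕ)
    (hHilb : ∀ n : ℤ, (hM n : WithBot ℕ∞) = Order.krullDim (Submodule A (ℳ n)))
    (hd : 1 ≤ d)
    (P : Polynomial ℚ)
    (hP : ∃ N : ℤ, ∀ n : ℤ, N ≤ n → P.eval (n : ℚ) = hM n)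
    (k : ℤ) (hk : P.eval (k : ℚ) = hM k) :
    ∀ n : ℤ, k ≤ n → P.eval (n : ℚ) = hM n := by
  have hnoeth : IsNoetherianRing R := Algebra.FiniteType.isNoetherianRing A R
  have hlen : ∀ n, Module.length A (ℳ n) = hM n := by
    intro n
    have := (hHilb n).trans (Module.coe_length A (ℳ n)).symm
    exact (WithBot.coe_injective this).symm
  have hfin : ∀ n, Module.length A (ℳ n) ≠ ⊤ := fun n => by rw [hlen]; exact ENat.natCast_ne_top _
  have hL : ∀ n, HilbCM.L ℳ (⊥ : Submodule R M) n = hM n := by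
    intro n
    have hV : HilbCM.V ℳ (⊥ : Submodule R M) n = ⊥ := by
      ext m
      simp [HilbCM.mem_V]
    rw [HilbCM.L, hV, (Submodule.quotEquivOfEqBot (⊥ : Submodule A (ℳ n)) rfl).length_eq, hlen]
    rfl
  obtain ⟨N0, hN0⟩ := hP
  obtain ⟨D, hD⟩ := HilbCM.exists_bound 𝒜 ℳ hcompat hstd
  obtain ⟨rs, hrs, hI, hreg⟩ := hCM
  have hdep := HilbCM.dep_of_weaklyRegular (I := HilbCM.mm 𝒜) rs hI hreg.toIsWeaklyRegular
  rw [hrs] at hdep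
  have hdim' : Module.supportDim R (M ⧸ (⊥ : Submodule R M)) ≤ d := by
    rw [Module.supportDim_eq_of_equiv (Submodule.quotEquivOfEqBot (⊥ : Submodule R M) rfl),
      Module.supportDim_eq_ringKrullDim_quotient_annihilator, hdim]
  intro n hn
  have := HilbCM.main_induction 𝒜 ℳ hcompat hfin D hD d ⊥
    (fun m hm i => by rw [(Submodule.mem_bot R).1 hm, HilbCM.comp_zero]; exact Submodule.zero_mem _)
    hdep hdim' P k N0 (Or.inl hd) (fun n hn => by rw [hL]; exact hN0 n hn) (by rw [hL]; exact hk) n hn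
  rwa [hL] at this
end

section
/- Every cave C ⊂ ℕ^p is a generalized polymatroid, i.e., C satisfies the Exchange and Expansion properties (equivalently, the homogenization C^hom is a base polymatroid). -/
open Finset

/-- The `i`-th standard basis vector of `ℕ^p`. -/
def ev {p : ℕ} (i : Fin p) : Fin p → ℕ := fun k => if k = i then 1 else 0

/-- The coordinate sum `|u|` of a lattice point. -/
def degSum {p : ℕ} (u : Fin p → ℕ) : ℕ := ∑ i, u i

/-- `step u i j = u - e_i + e_j` (truncated subtraction; used when `u i > 0`). -/
def step {p : ℕ} (u : Fin p → ℕ) (i j : Fin p) : Fin p → ℕ :=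
  fun k => u k + ev j k - ev i k

/-- A (base) polymatroid: a finite homogeneous subset of `ℕ^p` satisfying the
exchange property. -/
def IsBasePolymatroid {p : ℕ} (P : Finset (Fin p → ℕ)) : Prop :=
  (∀ u ∈ P, ∀ v ∈ P, degSum u = degSum v) ∧
  (∀ u ∈ P, ∀ v ∈ P, ∀ i : Fin p, v i < u i →
    ∃ j : Fin p, u j < v j ∧ step u i j ∈ P)

/-- `max(A) = max {|a| : a ∈ A}`. -/
def maxDeg {p : ℕ} (A : Finset (Fin p → ℕ)) : ℕ := A.sup degSum

/-- The homogenization `A^hom ⊆ ℕ^(p+1)` of a finite set `A ⊆ ℕ^p`. -/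
def homog {p : ℕ} (A : Finset (Fin p → ℕ)) : Finset (Fin (p + 1) → ℕ) :=
  A.image (fun a => Fin.snoc a (maxDeg A - degSum a))

/-- A generalized polymatroid: a finite set whose homogenization is a base polymatroid. -/
def IsGPolymatroid {p : ℕ} (G : Finset (Fin p → ℕ)) : Prop :=
  IsBasePolymatroid (homog G)

open scoped Classical

/-- The `b`-truncation `A_b = {a ∈ A : a ≥ b}`. -/
noncomputable def trunc {p : ℕ} (C : Finset (Fin p → ℕ)) (b : Fin p → ℕ) :
    Finset (Fin p → ℕ) :=
  C.filter (fun a => ∀ i, b i ≤ a i)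

/-- The top of a finite set: the elements of maximal coordinate sum. -/
noncomputable def topOf {p : ℕ} (A : Finset (Fin p → ℕ)) : Finset (Fin p → ℕ) :=
  A.filter (fun a => degSum a = maxDeg A)

/-- The stalactite `St(u; I) = {u - Σ_{ℓ ∈ J} e_ℓ : J ⊆ I}`. -/
noncomputable def stalactite {p : ℕ} (u : Fin p → ℕ) (I : Finset (Fin p)) :
    Finset (Fin p → ℕ) :=
  I.powerset.image (fun J => fun k => u k - (if k ∈ J then 1 else 0))

/-- The directions `ℓ` in which `u` has a neighbor `u - e_ℓ + e_j` in `V`. -/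
noncomputable def stalDirs {p : ℕ} (u : Fin p → ℕ) (V : Finset (Fin p → ℕ)) :
    Finset (Fin p) :=
  Finset.univ.filter (fun ℓ => 0 < u ℓ ∧ ∃ j, j ≠ ℓ ∧ step u ℓ j ∈ V)

/-- The lexicographic order on `ℕ^p` induced by the ordering `σ` of `[p]`. -/
def lexLt {p : ℕ} (σ : Equiv.Perm (Fin p)) (u v : Fin p → ℕ) : Prop :=
  ∃ i : Fin p, u (σ i) < v (σ i) ∧ ∀ j, j < i → u (σ j) = v (σ j)

/-- Condition (b) in the definition of a cave: for every ordering of `[p]`,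
the set is the union of the stalactites of its top elements, each taken with
respect to the lex-smaller top elements. -/
noncomputable def CaveCondB {p : ℕ} (A : Finset (Fin p → ℕ)) : Prop :=
  ∀ σ : Equiv.Perm (Fin p),
    A = (topOf A).biUnion (fun a =>
      stalactite a (stalDirs a ((topOf A).filter (fun b => lexLt σ b a))))

/-- A cave: a finite subset of `ℕ^p` all of whose truncations `A = C_b` satisfy
(a) `A^top` is a base polymatroid, (b) the stalactite decomposition condition for
every ordering of `[p]`, and (c) if `b ≠ 0` then `A` is a generalized polymatroid. -/
noncomputable def IsCave {p : ℕ} (C : Finset (Fin p → ℕ)) : Prop :=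
  ∀ b : Fin p → ℕ,
    IsBasePolymatroid (topOf (trunc C b)) ∧
    CaveCondB (trunc C b) ∧
    (b ≠ (fun _ => 0) → IsGPolymatroid (trunc C b))

/-! ### Elementary facts on `step` -/

lemma step_sum {p : ℕ} (u : Fin p → ℕ) (i j : Fin p) (hi : 0 < u i) (S : Finset (Fin p)) :
    ∑ k ∈ S, step u i j k + (if i ∈ S then 1 else 0) =
      ∑ k ∈ S, u k + (if j ∈ S then 1 else 0) := by
  have h1 : ∑ k ∈ S, ev i k = if i ∈ S then 1 else 0 := by simp [ev]
  have h2 : ∑ k ∈ S, ev j k = if j ∈ S then 1 else 0 := by simp [ev]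
  rw [← h1, ← h2, ← Finset.sum_add_distrib, ← Finset.sum_add_distrib]
  apply Finset.sum_congr rfl
  intro k _
  by_cases hk : k = i
  · subst hk; simp only [step, ev]; split_ifs <;> omega
  · simp only [step, ev]; split_ifs <;> omega

lemma base_trans {p : ℕ} {P : Finset (Fin p → ℕ)} (hP : IsBasePolymatroid P)
    {a : Fin p → ℕ} {l x y : Fin p} (hlx : l ≠ x) (hxy : x ≠ y) (hly : l ≠ y)
    (hl : 0 < a l) (hx : 0 < a x)
    (h1 : step a l x ∈ P) (h2 : step a x y ∈ P) : step a l y ∈ P := by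
  obtain ⟨m, hm, hm'⟩ := hP.2 _ h2 _ h1 l (by simp [step, ev, hlx, hly]; omega)
  have hmx : m = x := by
    by_contra hne
    simp only [step, ev, if_neg hne] at hm
    split_ifs at hm <;> omega
  subst hmx
  have : step (step a m y) l m = step a l y := by
    funext k
    by_cases hk : k = m
    · subst hk; simp only [step, ev]; split_ifs <;> grind
    · simp only [step, ev]; split_ifs <;> grind
  rwa [this] at hm'

lemma base_local {p : ℕ} {P : Finset (Fin p → ℕ)} (hP : IsBasePolymatroid P)
    {a : Fin p → ℕ} (ha : a ∈ P) {l j x y : Fin p} (hl : 0 < a l) (hjl : j ≠ l) 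
    (hyl : y ≠ l) (hyj : y ≠ j) (hyx : y ≠ x) (hx : 0 < step a l j x)
    (h2 : step (step a l j) x y ∈ P) :
    step a l y ∈ P ∨ (0 < a x ∧ step a x y ∈ P) := by
  by_cases hxj : x = j
  · subst hxj
    left
    have : step (step a l x) x y = step a l y := by
      funext k
      simp only [step, ev]; split_ifs <;> grind
    rwa [this] at h2
  have hax : 0 < a x := by
    simp only [step, ev, if_neg hxj] at hx
    split_ifs at hx <;> omega
  obtain ⟨m, hm, hm'⟩ := hP.2 _ h2 _ ha j (by
    simp only [step, ev, if_neg hjl, if_neg (Ne.symm hyj), if_neg (Ne.symm hxj)]; simp)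
  have hm2 : m = l ∨ m = x := by
    by_contra hne
    push Not at hne
    simp only [step, ev, if_neg hne.1, if_neg hne.2] at hm
    split_ifs at hm <;> omega
  have hx' := hx
  simp only [step, ev, if_neg hxj] at hx'
  rcases hm2 with rfl | rfl
  · right
    refine ⟨hax, ?_⟩
    have : step (step (step a m j) x y) j m = step a x y := by
      funext k
      simp only [step, ev]; split_ifs <;> grind
    rwa [this] at hm'
  · left
    have : step (step (step a l j) m y) j m = step a l y := by
      funext k
      simp only [step, ev]; split_ifs <;> grind
    rwa [this] at hm'

/-- A set which is closed under exchanges out of `a` is minimized by `a`. -/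
lemma base_tight {p : ℕ} {P : Finset (Fin p → ℕ)} (hP : IsBasePolymatroid P)
    (T : Finset (Fin p)) {c : Fin p → ℕ} (hc : c ∈ P) :
    ∀ (n : ℕ) (a : Fin p → ℕ), a ∈ P → (∑ k, (a k - c k) ≤ n) →
      (∀ l ∈ T, ∀ j ∉ T, 0 < a l → step a l j ∉ P) → ∑ k ∈ T, a k ≤ ∑ k ∈ T, c k := by
  intro n
  induction n with
  | zero =>
    intro a _ hd _
    apply Finset.sum_le_sum
    intro k _
    have : a k - c k ≤ ∑ k, (a k - c k) :=
      Finset.single_le_sum (f := fun k => a k - c k) (fun _ _ => Nat.zero_le _) (Finset.mem_univ k)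
    omega
  | succ n ih =>
    intro a ha hd hcl
    by_contra hlt
    push Not at hlt
    obtain ⟨l, hlT, hl⟩ := Finset.exists_lt_of_sum_lt hlt
    obtain ⟨j, hj, hjP⟩ := hP.2 a ha c hc l hl
    have hal : 0 < a l := by omega
    have hjl : j ≠ l := by rintro rfl; omega
    have hjT : j ∈ T := by
      by_contra hjT
      exact hcl l hlT j hjT hal hjP
    have hs := step_sum a l j hal T
    simp only [hlT, hjT, if_true] at hs
    have := ih (step a l j) hjP ?_ ?_
    · omega
    · have h2 : ∑ k, (step a l j k - c k) < ∑ k, (a k - c k) := by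
        apply Finset.sum_lt_sum
        · intro k _
          by_cases hk : k = j
          · subst hk; simp only [step, ev]; split_ifs <;> omega
          · simp only [step, ev, if_neg hk]; split_ifs <;> omega
        · refine ⟨l, Finset.mem_univ _, ?_⟩
          simp only [step, ev, if_neg (Ne.symm hjl)]; simp; omega
      omega
    · intro x hx y hy hpos hmem
      have hne : ∀ z ∈ T, y ≠ z := by rintro z hz rfl; exact hy hz
      rcases base_local hP ha hal hjl (hne l hlT) (hne j hjT) (hne x hx) hpos hmem with h | ⟨h, h'⟩
      · exact hcl l hlT y hy hal h
      · exact hcl x hx y hy h h'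

lemma base_tight' {p : ℕ} {P : Finset (Fin p → ℕ)} (hP : IsBasePolymatroid P)
    (T : Finset (Fin p)) {a c : Fin p → ℕ} (ha : a ∈ P) (hc : c ∈ P)
    (h : ∀ l ∈ T, ∀ j ∉ T, 0 < a l → step a l j ∉ P) : ∑ k ∈ T, a k ≤ ∑ k ∈ T, c k :=
  base_tight hP T hc _ a ha le_rfl h

/-- The set of directions reachable from `l`. -/
noncomputable def reach {p : ℕ} (P : Finset (Fin p → ℕ)) (a : Fin p → ℕ) (l : Fin p) :
    Finset (Fin p) :=
  Finset.univ.filter (fun j => j = l ∨ step a l j ∈ P)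

/-- The set of directions that reach `l`. -/
noncomputable def coreach {p : ℕ} (P : Finset (Fin p → ℕ)) (a : Fin p → ℕ) (l : Fin p) :
    Finset (Fin p) :=
  Finset.univ.filter (fun j => j = l ∨ (0 < a j ∧ step a j l ∈ P))

lemma reach_tight {p : ℕ} {P : Finset (Fin p → ℕ)} (hP : IsBasePolymatroid P)
    {a c : Fin p → ℕ} (ha : a ∈ P) (hc : c ∈ P) (l : Fin p) (hl : 0 < a l) :
    ∑ k ∈ reach P a l, a k ≤ ∑ k ∈ reach P a l, c k := by
  apply base_tight' hP _ ha hc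
  intro x hx y hy hax hxy
  simp only [reach, Finset.mem_filter, Finset.mem_univ, true_and, not_or] at hx hy
  rcases hx with rfl | hx
  · exact hy.2 hxy
  · by_cases hlx : l = x
    · subst hlx; exact hy.2 hxy
    by_cases hxy' : x = y
    · subst hxy'; exact hy.2 hx
    exact hy.2 (base_trans hP hlx hxy' (Ne.symm hy.1) hl hax hx hxy)

lemma coreach_tight {p : ℕ} {P : Finset (Fin p → ℕ)} (hP : IsBasePolymatroid P)
    {a c : Fin p → ℕ} (ha : a ∈ P) (hc : c ∈ P) (l : Fin p) :
    ∑ k ∈ coreach P a l, c k ≤ ∑ k ∈ coreach P a l, a k := by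
  have h : ∑ k ∈ (coreach P a l)ᶜ, a k ≤ ∑ k ∈ (coreach P a l)ᶜ, c k := by
    apply base_tight' hP _ ha hc
    intro x hx y hy hax hxy
    simp only [coreach, Finset.mem_filter, Finset.mem_univ, true_and,
      Finset.mem_compl, not_not] at hx hy
    rw [not_or] at hx
    by_cases hyl : y = l
    · subst hyl; exact hx.2 ⟨hax, hxy⟩
    rcases hy with rfl | ⟨hay, hy⟩
    · exact hyl rfl
    · by_cases hxy' : x = y
      · subst hxy'; exact hx.2 ⟨hay, hy⟩
      exact hx.2 ⟨hax, base_trans hP hxy' hyl hx.1 hax hay hxy hy⟩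
  have h1 := Finset.sum_add_sum_compl (coreach P a l) a
  have h2 := Finset.sum_add_sum_compl (coreach P a l) c
  have h3 := hP.1 a ha c hc
  unfold degSum at h3
  omega

/-- A base within the unit box above `u`. -/
lemma exists_box {p : ℕ} {P : Finset (Fin p → ℕ)} (hP : IsBasePolymatroid P)
    (hne : P.Nonempty) (u : Fin p → ℕ)
    (hL : ∀ S : Finset (Fin p), S.Nonempty →
      ∃ c ∈ P, ∑ k ∈ S, c k + 1 ≤ ∑ k ∈ S, u k + S.card)
    (hU : ∀ S : Finset (Fin p), ∃ c ∈ P, ∑ k ∈ S, u k ≤ ∑ k ∈ S, c k) :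
    ∃ a ∈ P, ∀ k, u k ≤ a k ∧ a k ≤ u k + 1 := by
  obtain ⟨a, ha, hmin⟩ := Finset.exists_min_image P
    (fun a => ∑ k, ((a k - (u k + 1)) + (u k - a k))) hne
  refine ⟨a, ha, ?_⟩
  by_contra hcon
  push Not at hcon
  obtain ⟨l, hl⟩ := hcon
  have key : ∀ i j : Fin p, i ≠ j → step a i j ∈ P → u i < a i → a j ≤ u j →
      (u i + 1 < a i ∨ a j < u j) → False := by
    intro i j hij hst h1 h2 h3
    have h := hmin _ hst
    apply absurd h
    push Not
    apply Finset.sum_lt_sum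
    · intro k _
      by_cases hk : k = i
      · subst hk; simp only [step, ev, if_neg hij]; simp; omega
      · by_cases hk' : k = j
        · subst hk'; simp only [step, ev, if_neg hk]; simp; omega
        · simp only [step, ev, if_neg hk, if_neg hk']; simp
    · rcases h3 with h3 | h3
      · refine ⟨i, Finset.mem_univ _, ?_⟩
        simp only [step, ev, if_neg hij]; simp; omega
      · refine ⟨j, Finset.mem_univ _, ?_⟩
        simp only [step, ev, if_neg (Ne.symm hij)]; simp; omega
  by_cases hul : u l ≤ a l
  · have hl' := hl hul
    have hlm : l ∈ reach P a l := by simp [reach]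
    obtain ⟨c, hc, hcS⟩ := hL (reach P a l) ⟨l, hlm⟩
    have ht := reach_tight hP ha hc l (by omega)
    have : ∃ t ∈ reach P a l, a t < u t + 1 := by
      apply Finset.exists_lt_of_sum_lt
      rw [Finset.sum_add_distrib]; simp; omega
    obtain ⟨t, htm, htl⟩ := this
    have htne : l ≠ t := by rintro rfl; omega
    simp only [reach, Finset.mem_filter, Finset.mem_univ, true_and] at htm
    rcases htm with rfl | htm
    · exact htne rfl
    exact key l t htne htm (by omega) (by omega) (by omega)
  · push Not at hul
    obtain ⟨c, hc, hcS⟩ := hU (coreach P a l)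
    have ht := coreach_tight hP ha hc l
    have : ∃ t ∈ coreach P a l, u t < a t := by
      by_contra hno
      push Not at hno
      have : ∑ k ∈ coreach P a l, a k < ∑ k ∈ coreach P a l, u k :=
        Finset.sum_lt_sum hno ⟨l, by simp [coreach], hul⟩
      omega
    obtain ⟨t, htm, htl⟩ := this
    have htne : t ≠ l := by rintro rfl; omega
    simp only [coreach, Finset.mem_filter, Finset.mem_univ, true_and] at htm
    rcases htm with rfl | htm
    · exact htne rfl
    exact key t l htne htm.2 (by omega) (by omega) (by omega)

lemma exists_order {p : ℕ} (f : Fin p → ℕ) :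
    ∃ σ : Equiv.Perm (Fin p), ∀ l j, f l < f j → σ.symm l < σ.symm j := by
  refine ⟨Tuple.sort f, fun l j h => ?_⟩
  by_contra hle
  push Not at hle
  have := Tuple.monotone_sort f hle
  simp at this
  omega

/-- Sufficient condition for membership. -/
lemma mem_of_ineq {p : ℕ} {C : Finset (Fin p → ℕ)} (hP : IsBasePolymatroid (topOf C))
    (hB : CaveCondB C) (hne : (topOf C).Nonempty) (u : Fin p → ℕ)
    (hL : ∀ S : Finset (Fin p), S.Nonempty →
      ∃ c ∈ topOf C, ∑ k ∈ S, c k + 1 ≤ ∑ k ∈ S, u k + S.card)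
    (hU : ∀ S : Finset (Fin p), ∃ c ∈ topOf C, ∑ k ∈ S, u k ≤ ∑ k ∈ S, c k) : u ∈ C := by
  obtain ⟨a, ha, hbox⟩ := exists_box hP hne u hL hU
  obtain ⟨σ, hσ⟩ := exists_order (fun k => if u k < a k then 0 else 1)
  have hBσ := hB σ
  rw [hBσ, Finset.mem_biUnion]
  refine ⟨a, ha, ?_⟩
  unfold stalactite
  rw [Finset.mem_image]
  refine ⟨Finset.univ.filter (fun k => u k < a k), ?_, ?_⟩
  · rw [Finset.mem_powerset]
    intro l hl
    simp only [Finset.mem_filter, Finset.mem_univ, true_and] at hl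
    have hal : 0 < a l := by omega
    obtain ⟨c, hc, hcS⟩ := hL (reach (topOf C) a l) ⟨l, by simp [reach]⟩
    have ht := reach_tight hP ha hc l hal
    have : ∃ t ∈ reach (topOf C) a l, a t < u t + 1 := by
      apply Finset.exists_lt_of_sum_lt
      rw [Finset.sum_add_distrib]; simp; omega
    obtain ⟨t, htm, htl⟩ := this
    have htne : t ≠ l := by rintro rfl; omega
    simp only [reach, Finset.mem_filter, Finset.mem_univ, true_and] at htm
    rcases htm with rfl | htm
    · exact absurd rfl htne
    simp only [stalDirs, Finset.mem_filter, Finset.mem_univ, true_and]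
    refine ⟨hal, t, htne, htm, σ.symm l, ?_, ?_⟩
    · simp only [Equiv.apply_symm_apply, step, ev, if_neg (Ne.symm htne)]; simp; omega
    · intro j hj
      have h1 : σ j ≠ l := by rintro rfl; simp at hj
      have h2 : σ j ≠ t := by
        rintro rfl
        have := hσ l (σ j) (by rw [if_pos hl, if_neg (by omega)]; omega)
        simp at this
        omega
      simp [step, ev, h1, h2]
  · funext k
    have := hbox k
    simp only [Finset.mem_filter, Finset.mem_univ, true_and]
    split_ifs <;> omega

/-- Necessary condition for membership. -/
lemma box_of_mem {p : ℕ} {C : Finset (Fin p → ℕ)} (hB : CaveCondB C) {u : Fin p → ℕ}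
    (hu : u ∈ C) (i : Fin p) : ∃ a ∈ topOf C, a i = u i ∧ ∀ k, u k ≤ a k ∧ a k ≤ u k + 1 := by
  obtain ⟨σ, hσ⟩ := exists_order (fun k => if k = i then 1 else 0)
  rw [hB σ, Finset.mem_biUnion] at hu
  obtain ⟨a, ha, hu⟩ := hu
  unfold stalactite at hu
  rw [Finset.mem_image] at hu
  obtain ⟨J, hJ, rfl⟩ := hu
  rw [Finset.mem_powerset] at hJ
  refine ⟨a, ha, ?_, ?_⟩
  · have : i ∉ J := by
      intro hi
      have := hJ hi
      simp only [stalDirs, Finset.mem_filter, Finset.mem_univ, true_and] at this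
      obtain ⟨hai, j, hji, _, q, hq, hq'⟩ := this
      have hqi : σ q = i := by
        by_contra hne
        simp only [step, ev, if_neg hne] at hq
        omega
      have hlt := hσ j i (by simp [hji])
      rw [← hqi] at hlt
      simp only [Equiv.symm_apply_apply] at hlt
      have := hq' _ hlt
      simp [step, ev, hji] at this
    simp [this]
  · intro k
    dsimp only
    split_ifs <;> omega

/-- The minimum of `c(S)` over `P`. -/
noncomputable def gmin {p : ℕ} (P : Finset (Fin p → ℕ)) (hne : P.Nonempty)
    (S : Finset (Fin p)) : ℕ :=
  P.inf' hne (fun c => ∑ k ∈ S, c k)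

lemma gmin_le {p : ℕ} {P : Finset (Fin p → ℕ)} (hne : P.Nonempty)
    (S : Finset (Fin p)) {c : Fin p → ℕ} (hc : c ∈ P) : gmin P hne S ≤ ∑ k ∈ S, c k :=
  Finset.inf'_le _ hc

lemma gmin_exists {p : ℕ} {P : Finset (Fin p → ℕ)} (hne : P.Nonempty)
    (S : Finset (Fin p)) : ∃ c ∈ P, gmin P hne S = ∑ k ∈ S, c k :=
  Finset.exists_mem_eq_inf' hne _

lemma gmin_super {p : ℕ} {P : Finset (Fin p → ℕ)} (hP : IsBasePolymatroid P)
    (hne : P.Nonempty) (S T : Finset (Fin p)) :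
    gmin P hne S + gmin P hne T ≤ gmin P hne (S ∪ T) + gmin P hne (S ∩ T) := by
  obtain ⟨c0, hc0, hc0'⟩ := gmin_exists hne (S ∩ T)
  obtain ⟨a, ha, hmin⟩ := Finset.exists_min_image
    (P.filter (fun c => ∑ k ∈ S ∩ T, c k = gmin P hne (S ∩ T)))
    (fun a => ∑ k ∈ S ∪ T, a k) ⟨c0, by simp [hc0, hc0']⟩
  rw [Finset.mem_filter] at ha
  obtain ⟨ha, hai⟩ := ha
  have hau : ∑ k ∈ S ∪ T, a k ≤ gmin P hne (S ∪ T) := by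
    obtain ⟨c1, hc1, hc1'⟩ := gmin_exists hne (S ∪ T)
    rw [hc1']
    apply base_tight' hP _ ha hc1
    intro l hl j hj hal hst
    have hjI : j ∉ S ∩ T := fun h => hj (by
      rw [Finset.mem_inter] at h; exact Finset.mem_union_left _ h.1)
    have h1 := step_sum a l j hal (S ∩ T)
    have h2 := step_sum a l j hal (S ∪ T)
    have h3 := gmin_le hne (S ∩ T) hst
    simp only [hjI, hl, hj, if_true, if_false] at h1 h2
    have h4 : ∑ k ∈ S ∩ T, step a l j k = gmin P hne (S ∩ T) := by
      split_ifs at h1 <;> omega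
    have := hmin (step a l j) (by rw [Finset.mem_filter]; exact ⟨hst, h4⟩)
    omega
  have h1 := gmin_le hne S ha
  have h2 := gmin_le hne T ha
  have h3 := Finset.sum_union_inter (s₁ := S) (s₂ := T) (f := a)
  omega

/-- Bases of an intersecting supermodular function satisfy exchange. -/
lemma abstract_exchange {n : ℕ} (h : Finset (Fin n) → ℤ)
    (hsup : ∀ S T : Finset (Fin n), (S ∩ T).Nonempty → h S + h T ≤ h (S ∪ T) + h (S ∩ T))
    (w z : Fin n → ℕ) (hwu : ((∑ k, w k : ℕ) : ℤ) = h Finset.univ)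
    (hw : ∀ S : Finset (Fin n), S.Nonempty → h S ≤ ((∑ k ∈ S, w k : ℕ) : ℤ))
    (hz : ∀ S : Finset (Fin n), S.Nonempty → h S ≤ ((∑ k ∈ S, z k : ℕ) : ℤ))
    (i : Fin n) (hi : z i < w i) :
    ∃ j, w j < z j ∧ ((∑ k, step w i j k : ℕ) : ℤ) = h Finset.univ ∧
      ∀ S : Finset (Fin n), S.Nonempty → h S ≤ ((∑ k ∈ S, step w i j k : ℕ) : ℤ) := by
  obtain ⟨D, hD, hDmin⟩ := Finset.exists_min_image
    (Finset.univ.filter (fun S : Finset (Fin n) => i ∈ S ∧ ((∑ k ∈ S, w k : ℕ) : ℤ) = h S))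
    Finset.card ⟨Finset.univ, by simp only [Finset.mem_filter, Finset.mem_univ, true_and, hwu]⟩
  simp only [Finset.mem_filter, Finset.mem_univ, true_and] at hD hDmin
  obtain ⟨hiD, hDt⟩ := hD
  have hsub : ∀ S : Finset (Fin n), i ∈ S → ((∑ k ∈ S, w k : ℕ) : ℤ) = h S → D ⊆ S := by
    intro S hiS hS
    have hin : i ∈ S ∩ D := Finset.mem_inter.2 ⟨hiS, hiD⟩
    have h1 := hsup S D ⟨i, hin⟩
    have h2 := hw (S ∪ D) ⟨i, Finset.mem_union_left _ hiS⟩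
    have h3 := hw (S ∩ D) ⟨i, hin⟩
    have h4 := Finset.sum_union_inter (s₁ := S) (s₂ := D) (f := w)
    have h5 := hDmin (S ∩ D) ⟨hin, by omega⟩
    have h6 := Finset.eq_of_subset_of_card_le (Finset.inter_subset_right (s₁ := S) (s₂ := D)) h5
    rw [← h6]
    exact Finset.inter_subset_left
  have hj : ∃ j ∈ D, w j < z j := by
    by_contra hno
    push Not at hno
    have h1 : ∑ k ∈ D, z k < ∑ k ∈ D, w k := Finset.sum_lt_sum hno ⟨i, hiD, hi⟩
    have h2 := hz D ⟨i, hiD⟩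
    omega
  obtain ⟨j, hjD, hj⟩ := hj
  have hwi : 0 < w i := by omega
  refine ⟨j, hj, ?_, ?_⟩
  · have := step_sum w i j hwi Finset.univ
    simp only [Finset.mem_univ, if_true] at this
    omega
  · intro S hS
    have h1 := step_sum w i j hwi S
    have h2 := hw S hS
    by_cases hiS : i ∈ S
    · by_cases hjS : j ∈ S
      · simp only [hiS, hjS, if_true] at h1
        omega
      · have : ((∑ k ∈ S, w k : ℕ) : ℤ) ≠ h S := fun he => hjS (hsub S hiS he hjD)
        simp only [hiS, hjS, if_true, if_false] at h1
        omega
    · simp only [hiS, if_false] at h1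
      omega

/-- Restriction of a subset of `Fin (p+1)` to `Fin p`. -/
noncomputable def pre {p : ℕ} (S : Finset (Fin (p + 1))) : Finset (Fin p) :=
  Finset.univ.filter (fun k => Fin.castSucc k ∈ S)

lemma sum_pre {p : ℕ} (w : Fin (p + 1) → ℕ) (S : Finset (Fin (p + 1))) :
    ∑ k ∈ S, w k = ∑ k ∈ pre S, w (Fin.castSucc k) + if Fin.last p ∈ S then w (Fin.last p) else 0 := by
  have : ∑ k ∈ S, w k = ∑ k, if k ∈ S then w k else 0 := by simp
  rw [this, Fin.sum_univ_castSucc, pre, Finset.sum_filter]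

/-- The intersecting supermodular function describing the homogenization. -/
noncomputable def hfun {p : ℕ} (P : Finset (Fin p → ℕ)) (hne : P.Nonempty)
    (S : Finset (Fin (p + 1))) : ℤ :=
  (gmin P hne (pre S) : ℤ) + if Fin.last p ∈ S then 0 else 1 - ((pre S).card : ℤ)

lemma pre_union {p : ℕ} (S T : Finset (Fin (p + 1))) : pre (S ∪ T) = pre S ∪ pre T := by
  ext k; simp [pre]

lemma pre_inter {p : ℕ} (S T : Finset (Fin (p + 1))) : pre (S ∩ T) = pre S ∩ pre T := by
  ext k; simp [pre]

lemma hfun_super {p : ℕ} {P : Finset (Fin p → ℕ)} (hP : IsBasePolymatroid P)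
    (hne : P.Nonempty) (S T : Finset (Fin (p + 1))) :
    hfun P hne S + hfun P hne T ≤ hfun P hne (S ∪ T) + hfun P hne (S ∩ T) := by
  have h1 := gmin_super hP hne (pre S) (pre T)
  have h2 := Finset.card_union_add_card_inter (pre S) (pre T)
  have h3 := Finset.card_le_card (Finset.inter_subset_left (s₁ := pre S) (s₂ := pre T))
  have h4 := Finset.card_le_card (Finset.inter_subset_right (s₁ := pre S) (s₂ := pre T))
  unfold hfun
  rw [pre_union, pre_inter]
  by_cases hS : Fin.last p ∈ S <;> by_cases hT : Fin.last p ∈ T <;>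
    simp only [Finset.mem_union, Finset.mem_inter, hS, hT, or_true, true_or, and_true, and_false,
      false_and, or_false, if_true, if_false, and_self, or_self] <;> omega

lemma mem_homog_iff {p : ℕ} {C : Finset (Fin p → ℕ)} (hP : IsBasePolymatroid (topOf C))
    (hB : CaveCondB C) (hne : (topOf C).Nonempty) (w : Fin (p + 1) → ℕ) :
    w ∈ homog C ↔ ((∑ k, w k : ℕ) : ℤ) = hfun (topOf C) hne Finset.univ ∧
      ∀ S : Finset (Fin (p + 1)), S.Nonempty →
        hfun (topOf C) hne S ≤ ((∑ k ∈ S, w k : ℕ) : ℤ) := by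
  have hdeg : ∀ c ∈ topOf C, ∑ k, c k = maxDeg C := fun c hc => (Finset.mem_filter.1 hc).2
  have hpu : pre (Finset.univ : Finset (Fin (p + 1))) = Finset.univ := by ext; simp [pre]
  have hhu : hfun (topOf C) hne Finset.univ = maxDeg C := by
    obtain ⟨c, hc, hc'⟩ := gmin_exists hne Finset.univ
    simp only [hfun, hpu, hc', hdeg c hc, Finset.mem_univ, if_true, add_zero]
  rw [hhu]
  have hsum := Fin.sum_univ_castSucc w
  constructor
  · intro hw
    unfold homog at hw
    rw [Finset.mem_image] at hw
    obtain ⟨u, hu, rfl⟩ := hw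
    simp only [Fin.snoc_castSucc, Fin.snoc_last] at hsum
    have hle : degSum u ≤ maxDeg C := Finset.le_sup (f := degSum) hu
    have hdu : degSum u = ∑ k, u k := rfl
    refine ⟨by rw [hsum]; omega, ?_⟩
    intro S hS
    rw [sum_pre]
    unfold hfun
    simp only [Fin.snoc_castSucc, Fin.snoc_last]
    by_cases hl : Fin.last p ∈ S
    · simp only [hl, if_true]
      have : ∃ a ∈ topOf C, ∀ k, u k ≤ a k := by
        rcases Nat.eq_zero_or_pos p with rfl | hp
        · obtain ⟨a, ha⟩ := hne
          exact ⟨a, ha, fun k => k.elim0⟩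
        · obtain ⟨a, ha, _, h⟩ := box_of_mem hB hu ⟨0, hp⟩
          exact ⟨a, ha, fun k => (h k).1⟩
      obtain ⟨a, ha, hua⟩ := this
      have h1 := gmin_le hne (pre S) ha
      have h2 := Finset.sum_add_sum_compl (pre S) a
      have h3 := Finset.sum_add_sum_compl (pre S) u
      have h4 : ∑ k ∈ (pre S)ᶜ, u k ≤ ∑ k ∈ (pre S)ᶜ, a k := Finset.sum_le_sum fun k _ => hua k
      have h5 := hdeg a ha
      omega
    · simp only [hl, if_false]
      have : ∃ i, i ∈ pre S := by
        obtain ⟨x, hx⟩ := hS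
        rcases Fin.eq_castSucc_or_eq_last x with ⟨i, rfl⟩ | rfl
        · exact ⟨i, by simp [pre, hx]⟩
        · exact absurd hx hl
      obtain ⟨i, hi⟩ := this
      obtain ⟨a, ha, hai, hbox⟩ := box_of_mem hB hu i
      have h1 := gmin_le hne (pre S) ha
      have h2 : ∑ k ∈ pre S, a k < ∑ k ∈ pre S, (u k + 1) :=
        Finset.sum_lt_sum (fun k _ => (hbox k).2) ⟨i, hi, by omega⟩
      rw [Finset.sum_add_distrib] at h2
      simp at h2
      omega
  · rintro ⟨hwu, hw⟩
    have hmem : (fun k => w (Fin.castSucc k)) ∈ C := by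
      apply mem_of_ineq hP hB hne
      · intro S hS
        have hpre : pre (S.map Fin.castSuccEmb) = S := by ext k; simp [pre]
        have hl : Fin.last p ∉ S.map Fin.castSuccEmb := by
          simp [Fin.castSucc_ne_last]
        have h1 := hw (S.map Fin.castSuccEmb) (by simpa using hS)
        rw [sum_pre, hfun, hpre, if_neg hl, if_neg hl] at h1
        obtain ⟨c, hc, hc'⟩ := gmin_exists hne S
        exact ⟨c, hc, by omega⟩
      · intro S
        have hpre : pre (insert (Fin.last p) (Sᶜ.map Fin.castSuccEmb)) = Sᶜ := by
          ext k; simp [pre, Fin.castSucc_ne_last]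
        have hl : Fin.last p ∈ insert (Fin.last p) (Sᶜ.map Fin.castSuccEmb) :=
          Finset.mem_insert_self _ _
        have h1 := hw _ ⟨_, hl⟩
        rw [sum_pre, hfun, hpre, if_pos hl, if_pos hl] at h1
        obtain ⟨c, hc, hc'⟩ := gmin_exists hne Sᶜ
        have h2 := Finset.sum_add_sum_compl S c
        have h3 := Finset.sum_add_sum_compl S (fun k => w (Fin.castSucc k))
        have h4 := hdeg c hc
        exact ⟨c, hc, by omega⟩
    unfold homog
    rw [Finset.mem_image]
    refine ⟨_, hmem, ?_⟩
    funext k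
    refine Fin.lastCases ?_ (fun k => ?_) k
    · simp only [Fin.snoc_last, degSum]
      omega
    · simp only [Fin.snoc_castSucc]

/-- **Gluing generalized polymatroids**: every cave is a generalized polymatroid. -/
theorem cave_isGPolymatroid {p : ℕ} (C : Finset (Fin p → ℕ)) (hC : IsCave C) :
    IsGPolymatroid C := by
  have htr : trunc C (fun _ => 0) = C := by simp [trunc]
  obtain ⟨hP, hB, -⟩ := hC (fun _ => 0)
  rw [htr] at hP hB
  rcases C.eq_empty_or_nonempty with rfl | hCne
  · constructor <;> simp [homog]
  have hne : (topOf C).Nonempty := by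
    obtain ⟨a, ha, hmax⟩ := Finset.exists_mem_eq_sup C hCne degSum
    exact ⟨a, Finset.mem_filter.2 ⟨ha, hmax.symm⟩⟩
  have hiff := mem_homog_iff hP hB hne
  constructor
  · intro u hu v hv
    have h1 := ((hiff u).1 hu).1
    have h2 := ((hiff v).1 hv).1
    unfold degSum
    omega
  · intro u hu v hv i hi
    have h1 := (hiff u).1 hu
    have h2 := (hiff v).1 hv
    obtain ⟨j, hj, h3, h4⟩ := abstract_exchange (hfun (topOf C) hne)
      (fun S T _ => hfun_super hP hne S T) u v h1.1 h1.2 h2.2 i hi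
    exact ⟨j, hj, (hiff _).2 ⟨h3, h4⟩⟩
end
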